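/- Let G be a unicyclic graph. Then edim(G) = L(G) + max{0, 2−b(G)} + Δ_e, where Δ_e = 0 if G is ADE-negative and Δ_e = 1 if G is ADE-positive. -/

import Mathlib

open SimpleGraph

section Defs

variable {V : Type*}

/-- Distance from a vertex `s` to an edge `e`: the minimum of the distances to its endpoints. -/
noncomputable def edgeDist (G : SimpleGraph V) (s : V) (e : Sym2 V) : ℕ :=
  Sym2.lift ⟨fun u w => min (G.dist s u) (G.dist s w), fun u w => min_comm _ _⟩ e

/-- `S` is a vertex metric generator of `G`. -/
def IsVertexMG (G : SimpleGraph V) (S : Set V) : Prop :=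
  ∀ u v : V, u ≠ v → ∃ s ∈ S, G.dist s u ≠ G.dist s v

/-- `S` is an edge metric generator of `G`. -/
def IsEdgeMG (G : SimpleGraph V) (S : Set V) : Prop :=
  ∀ e ∈ G.edgeSet, ∀ f ∈ G.edgeSet, e ≠ f → ∃ s ∈ S, edgeDist G s e ≠ edgeDist G s f

/-- The vertex metric dimension of `G`. -/
noncomputable def metricDim (G : SimpleGraph V) : ℕ :=
  sInf {n | ∃ S : Finset V, S.card = n ∧ IsVertexMG G ↑S}

/-- The edge metric dimension of `G`. -/
noncomputable def edgeMetricDim (G : SimpleGraph V) : ℕ :=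
  sInf {n | ∃ S : Finset V, S.card = n ∧ IsEdgeMG G ↑S}

/-- `G` is unicyclic: connected, contains a cycle, and any two cycles have the same edges. -/
def IsUnicyclic (G : SimpleGraph V) : Prop :=
  G.Connected ∧ (∃ (u : V) (w : G.Walk u u), w.IsCycle) ∧
    ∀ (u u' : V) (w : G.Walk u u) (w' : G.Walk u' u'), w.IsCycle → w'.IsCycle →
      ∀ e, e ∈ w.edges ↔ e ∈ w'.edges

/-- `vc : ZMod g → V` is a labelling `v_0 v_1 ⋯ v_{g-1}` of a cycle of length `g` in `G`. -/
def IsCycleLabelling (G : SimpleGraph V) (g : ℕ) (vc : ZMod g → V) : Prop :=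
  Function.Injective vc ∧ ∀ i : ZMod g, G.Adj (vc i) (vc (i + 1))

/-- The set of edges of the cycle `C`. -/
def cycleEdges (g : ℕ) (vc : ZMod g → V) : Set (Sym2 V) :=
  {e | ∃ i : ZMod g, e = s(vc i, vc (i + 1))}

/-- The graph `G - E(C)`. -/
def offCycle (G : SimpleGraph V) (g : ℕ) (vc : ZMod g → V) : SimpleGraph V :=
  G.deleteEdges (cycleEdges g vc)

/-- `x` belongs to `T_{v_i}`, the connected component of `G - E(C)` containing `v_i`. -/
def inTree (G : SimpleGraph V) (g : ℕ) (vc : ZMod g → V) (i : ZMod g) (x : V) : Prop :=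
  (offCycle G g vc).Reachable (vc i) x

/-- The vertex `v_i` of the cycle is `S`-active: `T_{v_i}` contains a vertex of `S`. -/
def SActive (G : SimpleGraph V) (g : ℕ) (vc : ZMod g → V) (S : Set V) (i : ZMod g) : Prop :=
  ∃ s ∈ S, inTree G g vc i s

/-- `a_S(C)`: the number of `S`-active vertices on the cycle. -/
noncomputable def aS (G : SimpleGraph V) (g : ℕ) (vc : ZMod g → V) (S : Set V) : ℕ :=
  {i : ZMod g | SActive G g vc S i}.ncard

/-- `S` is biactive: `a_S(C) ≥ 2`. -/
def Biactive (G : SimpleGraph V) (g : ℕ) (vc : ZMod g → V) (S : Set V) : Prop :=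
  2 ≤ aS G g vc S

variable [Fintype V] [DecidableEq V]

/-- `t = u_1 u_2 ⋯ u_k` is a thread hanging at the vertex `v`. -/
def IsThreadAt (G : SimpleGraph V) [DecidableRel G.Adj] (v : V) (t : List V) : Prop :=
  t ≠ [] ∧ t.Nodup ∧ v ∉ t ∧ 3 ≤ G.degree v ∧ List.Chain' G.Adj t ∧
    (∀ u ∈ t.head?, G.Adj v u) ∧ (∀ u ∈ t.getLast?, G.degree u = 1) ∧
    ∀ u ∈ t.dropLast, G.degree u = 2

/-- The thread `t` is `S`-free: it contains no vertex of `S`. -/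
def SFree (S : Set V) (t : List V) : Prop := ∀ u ∈ t, u ∉ S

/-- `S` is branch-resolving: for every vertex, all threads hanging at it except possibly
one contain a vertex of `S` (i.e. at most one thread at each vertex is `S`-free). -/
def BranchResolving (G : SimpleGraph V) [DecidableRel G.Adj] (S : Set V) : Prop :=
  ∀ v : V, ∀ t₁ t₂ : List V, IsThreadAt G v t₁ → IsThreadAt G v t₂ → t₁ ≠ t₂ →
    (∃ s ∈ S, s ∈ t₁) ∨ (∃ s ∈ S, s ∈ t₂)

/-- `ℓ(v)`: the number of threads hanging at `v`. -/
noncomputable def numThreads (G : SimpleGraph V) [DecidableRel G.Adj] (v : V) : ℕ :=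
  {t : List V | IsThreadAt G v t}.ncard

/-- `L(G) = Σ (ℓ(v) - 1)` (truncated subtraction makes the sum run exactly over the
vertices with `ℓ(v) > 1`). -/
noncomputable def LG (G : SimpleGraph V) [DecidableRel G.Adj] : ℕ :=
  ∑ v : V, (numThreads G v - 1)

/-- `x` is a branching vertex of the unicyclic graph with cycle `vc`. -/
def Branching (G : SimpleGraph V) [DecidableRel G.Adj] (g : ℕ) (vc : ZMod g → V) (x : V) :
    Prop :=
  (x ∉ Set.range vc ∧ 3 ≤ G.degree x) ∨ (x ∈ Set.range vc ∧ 4 ≤ G.degree x)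

/-- The cycle vertex `v_i` is branch-active: `T_{v_i}` contains a branching vertex. -/
def BranchActive (G : SimpleGraph V) [DecidableRel G.Adj] (g : ℕ) (vc : ZMod g → V)
    (i : ZMod g) : Prop :=
  ∃ x, inTree G g vc i x ∧ Branching G g vc x

/-- `b(G)`: the number of branch-active vertices on the cycle. -/
noncomputable def bG (G : SimpleGraph V) [DecidableRel G.Adj] (g : ℕ) (vc : ZMod g → V) : ℕ :=
  {i : ZMod g | BranchActive G g vc i}.ncard

/-- `k = max { i : v_i is S-active }` for the labelling `vc` (indices taken in `[0, g-1]`). -/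
noncomputable def kOf (G : SimpleGraph V) (g : ℕ) (vc : ZMod g → V) (S : Set V) : ℕ :=
  sSup {n : ℕ | n < g ∧ SActive G g vc S (n : ZMod g)}

/-- The labelling `vc` of the cycle is canonical with respect to `S`: `v_0` is `S`-active
and `k` is as small as possible among all labellings of the cycle with `v_0` `S`-active. -/
def Canonical (G : SimpleGraph V) (g : ℕ) (vc : ZMod g → V) (S : Set V) : Prop :=
  IsCycleLabelling G g vc ∧ SActive G g vc S 0 ∧
    ∀ vc' : ZMod g → V, IsCycleLabelling G g vc' → Set.range vc' = Set.range vc →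
      SActive G g vc' S 0 → kOf G g vc S ≤ kOf G g vc' S

/-- Configuration 𝒜 : `a_S(C) = 2`, `g` even and `k = g/2`. -/
def ConfigA (G : SimpleGraph V) (g : ℕ) (vc : ZMod g → V) (S : Set V) : Prop :=
  aS G g vc S = 2 ∧ Even g ∧ kOf G g vc S = g / 2

/-- Configuration ℬ : `k ≤ ⌊g/2⌋ - 1` and an `S`-free thread hangs at `v_i` for some
`i ∈ [k, ⌊g/2⌋-1] ∪ [⌈g/2⌉+k+1, g-1] ∪ {0}`. -/
def ConfigB (G : SimpleGraph V) [DecidableRel G.Adj] (g : ℕ) (vc : ZMod g → V) (S : Set V) :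
    Prop :=
  kOf G g vc S ≤ g / 2 - 1 ∧
    ∃ i : ℕ, ((kOf G g vc S ≤ i ∧ i ≤ g / 2 - 1) ∨
        ((g + 1) / 2 + kOf G g vc S + 1 ≤ i ∧ i ≤ g - 1) ∨ i = 0) ∧
      ∃ t : List V, IsThreadAt G (vc (i : ZMod g)) t ∧ SFree S t

/-- Configuration 𝒞 : `a_S(C) = 2`, `g` even, `k ≤ g/2` and an `S`-free thread of length
`≥ g/2 - k` hangs at `v_i` for some `i ∈ [0, k]`. -/
def ConfigC (G : SimpleGraph V) [DecidableRel G.Adj] (g : ℕ) (vc : ZMod g → V) (S : Set V) :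
    Prop :=
  aS G g vc S = 2 ∧ Even g ∧ kOf G g vc S ≤ g / 2 ∧
    ∃ i : ℕ, i ≤ kOf G g vc S ∧
      ∃ t : List V, IsThreadAt G (vc (i : ZMod g)) t ∧ SFree S t ∧
        g / 2 - kOf G g vc S ≤ t.length

/-- Configuration 𝒟 : `k ≤ ⌈g/2⌉ - 1` and an `S`-free thread hangs at `v_i` for some
`i ∈ [k, ⌈g/2⌉-1] ∪ [⌊g/2⌋+k+1, g-1] ∪ {0}`. -/
def ConfigD (G : SimpleGraph V) [DecidableRel G.Adj] (g : ℕ) (vc : ZMod g → V) (S : Set V) :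
    Prop :=
  kOf G g vc S ≤ (g + 1) / 2 - 1 ∧
    ∃ i : ℕ, ((kOf G g vc S ≤ i ∧ i ≤ (g + 1) / 2 - 1) ∨
        (g / 2 + kOf G g vc S + 1 ≤ i ∧ i ≤ g - 1) ∨ i = 0) ∧
      ∃ t : List V, IsThreadAt G (vc (i : ZMod g)) t ∧ SFree S t

/-- Configuration ℰ : `a_S(C) = 2` and an `S`-free thread of length `≥ ⌊g/2⌋ - k + 1`
hangs at `v_i` with `i ∈ [0, k]`; moreover if `g` is even an `S`-free thread hangs at
`v_j` with `j = g/2 + k - i`. -/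
def ConfigE (G : SimpleGraph V) [DecidableRel G.Adj] (g : ℕ) (vc : ZMod g → V) (S : Set V) :
    Prop :=
  aS G g vc S = 2 ∧
    ∃ i : ℕ, i ≤ kOf G g vc S ∧
      (∃ t : List V, IsThreadAt G (vc (i : ZMod g)) t ∧ SFree S t ∧
        g / 2 - kOf G g vc S + 1 ≤ t.length) ∧
      (Even g → ∃ t' : List V,
        IsThreadAt G (vc ((g / 2 + kOf G g vc S - i : ℕ) : ZMod g)) t' ∧ SFree S t')

/-- `G` contains configuration 𝒜 with respect to `S` (evaluated on a canonical labelling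
of the cycle given by `vc`). -/
def ContainsA (G : SimpleGraph V) (g : ℕ) (vc : ZMod g → V) (S : Set V) : Prop :=
  ∃ vc' : ZMod g → V, IsCycleLabelling G g vc' ∧ Set.range vc' = Set.range vc ∧
    Canonical G g vc' S ∧ ConfigA G g vc' S

/-- `G` contains configuration ℬ with respect to `S`. -/
def ContainsB (G : SimpleGraph V) [DecidableRel G.Adj] (g : ℕ) (vc : ZMod g → V)
    (S : Set V) : Prop :=
  ∃ vc' : ZMod g → V, IsCycleLabelling G g vc' ∧ Set.range vc' = Set.range vc ∧
    Canonical G g vc' S ∧ ConfigB G g vc' S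

/-- `G` contains configuration 𝒞 with respect to `S`. -/
def ContainsC (G : SimpleGraph V) [DecidableRel G.Adj] (g : ℕ) (vc : ZMod g → V)
    (S : Set V) : Prop :=
  ∃ vc' : ZMod g → V, IsCycleLabelling G g vc' ∧ Set.range vc' = Set.range vc ∧
    Canonical G g vc' S ∧ ConfigC G g vc' S

/-- `G` contains configuration 𝒟 with respect to `S`. -/
def ContainsD (G : SimpleGraph V) [DecidableRel G.Adj] (g : ℕ) (vc : ZMod g → V)
    (S : Set V) : Prop :=
  ∃ vc' : ZMod g → V, IsCycleLabelling G g vc' ∧ Set.range vc' = Set.range vc ∧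
    Canonical G g vc' S ∧ ConfigD G g vc' S

/-- `G` contains configuration ℰ with respect to `S`. -/
def ContainsE (G : SimpleGraph V) [DecidableRel G.Adj] (g : ℕ) (vc : ZMod g → V)
    (S : Set V) : Prop :=
  ∃ vc' : ZMod g → V, IsCycleLabelling G g vc' ∧ Set.range vc' = Set.range vc ∧
    Canonical G g vc' S ∧ ConfigE G g vc' S

/-- `G` contains one of the configurations 𝒜, ℬ, 𝒞 with respect to `S`. -/
def ContainsABC (G : SimpleGraph V) [DecidableRel G.Adj] (g : ℕ) (vc : ZMod g → V)
    (S : Set V) : Prop :=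
  ContainsA G g vc S ∨ ContainsB G g vc S ∨ ContainsC G g vc S

/-- `G` contains one of the configurations 𝒜, 𝒟, ℰ with respect to `S`. -/
def ContainsADE (G : SimpleGraph V) [DecidableRel G.Adj] (g : ℕ) (vc : ZMod g → V)
    (S : Set V) : Prop :=
  ContainsA G g vc S ∨ ContainsD G g vc S ∨ ContainsE G g vc S

/-- `S` is a smallest branch-resolving set of `G`. -/
def SmallestBR (G : SimpleGraph V) [DecidableRel G.Adj] (S : Finset V) : Prop :=
  BranchResolving G ↑S ∧ ∀ S' : Finset V, BranchResolving G ↑S' → S.card ≤ S'.card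

/-- `S` is a smallest biactive branch-resolving set of `G`. -/
def SmallestBBR (G : SimpleGraph V) [DecidableRel G.Adj] (g : ℕ) (vc : ZMod g → V)
    (S : Finset V) : Prop :=
  BranchResolving G ↑S ∧ Biactive G g vc ↑S ∧
    ∀ S' : Finset V, BranchResolving G ↑S' → Biactive G g vc ↑S' → S.card ≤ S'.card

/-- `G` is 𝒜ℬ𝒞-negative. -/
def ABCneg (G : SimpleGraph V) [DecidableRel G.Adj] (g : ℕ) (vc : ZMod g → V) : Prop :=
  ∃ S : Finset V, SmallestBBR G g vc S ∧ ¬ ContainsABC G g vc ↑S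

/-- `G` is 𝒜𝒟ℰ-negative. -/
def ADEneg (G : SimpleGraph V) [DecidableRel G.Adj] (g : ℕ) (vc : ZMod g → V) : Prop :=
  ∃ S : Finset V, SmallestBBR G g vc S ∧ ¬ ContainsADE G g vc ↑S

end Defs

section Structure

variable {V : Type*} {G : SimpleGraph V} {g : ℕ} {vc : ZMod g → V}

theorem two_ne_zero_zmod (hg : 3 ≤ g) : (2 : ZMod g) ≠ 0 := by
  intro h
  have h2 : ((2 : ℕ) : ZMod g) = 0 := by exact_mod_cast h
  rw [ZMod.natCast_eq_zero_iff] at h2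
  have := Nat.le_of_dvd (by norm_num) h2
  omega

theorem one_ne_zero_zmod (hg : 3 ≤ g) : (1 : ZMod g) ≠ 0 := by
  intro h
  have h2 : ((1 : ℕ) : ZMod g) = 0 := by exact_mod_cast h
  rw [ZMod.natCast_eq_zero_iff] at h2
  have := Nat.le_of_dvd (by norm_num) h2
  omega

theorem cycleEdge_injective (hg : 3 ≤ g) (hinj : Function.Injective vc) {i j : ZMod g}
    (h : s(vc i, vc (i + 1)) = s(vc j, vc (j + 1))) : i = j := by
  rw [Sym2.eq_iff] at h
  rcases h with ⟨h, -⟩ | ⟨h1, h2⟩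
  · exact hinj h
  · have h1 := hinj h1
    have h2 := hinj h2
    exfalso
    apply two_ne_zero_zmod hg
    rw [h1] at h2
    linear_combination h2

/-- Deleting one edge of the cycle leaves all cycle vertices mutually reachable. -/
theorem reachable_cycle_of_adj {H : SimpleGraph V} [NeZero g] (j : ZMod g)
    (hadj : ∀ i, i ≠ j → H.Adj (vc i) (vc (i + 1))) (i : ZMod g) :
    H.Reachable (vc (j + 1)) (vc i) := by
  have key : ∀ n : ℕ, n < g → H.Reachable (vc (j + 1)) (vc (j + 1 + (n : ZMod g))) := by
    intro n
    induction n with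
    | zero => intro _; simp
    | succ n ih =>
      intro hn
      refine (ih (by omega)).trans ?_
      have hne : j + 1 + (n : ZMod g) ≠ j := by
        intro h
        have h2 : ((n + 1 : ℕ) : ZMod g) = 0 := by
          push_cast
          linear_combination h
        rw [ZMod.natCast_eq_zero_iff] at h2
        have := Nat.le_of_dvd (by omega) h2
        omega
      have := (hadj _ hne).reachable
      push_cast
      rwa [← add_assoc]
  have := key (i - (j + 1)).val (ZMod.val_lt _)
  simpa using this

theorem isBridge_of_notMem_cycleEdges (hG : IsUnicyclic G) (hg : 3 ≤ g)
    (hvc : IsCycleLabelling G g vc) {e : Sym2 V} (he : e ∈ G.edgeSet)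
    (hne : e ∉ cycleEdges g vc) : G.IsBridge e := by
  have : NeZero g := ⟨by omega⟩
  classical
  rw [isBridge_iff_forall_cycle_notMem he]
  intro u p hp hep
  let H : SimpleGraph V := SimpleGraph.fromEdgeSet (cycleEdges g vc)
  have hHadj : ∀ i, H.Adj (vc i) (vc (i + 1)) := fun i => by
    rw [SimpleGraph.fromEdgeSet_adj]
    exact ⟨⟨i, rfl⟩, (hvc.2 i).ne⟩
  have hHG : H ≤ G := by
    intro a b hab
    rw [SimpleGraph.fromEdgeSet_adj] at hab
    obtain ⟨⟨i, hi⟩, -⟩ := hab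
    have := hvc.2 i
    rw [← SimpleGraph.mem_edgeSet, ← hi] at this
    exact this
  have hnb : ¬ H.IsBridge s(vc 0, vc (0 + 1)) := by
    rw [isBridge_iff, not_not]
    refine (reachable_cycle_of_adj (vc := vc) (0 : ZMod g) (fun i hi => ?_) 0).symm
    rw [SimpleGraph.deleteEdges_adj]
    exact ⟨hHadj i, fun h => hi (cycleEdge_injective hg hvc.1 h)⟩
  rw [isBridge_iff_forall_cycle_notMem (hHadj 0)] at hnb
  push Not at hnb
  obtain ⟨w, q, hq, -⟩ := hnb
  have h1 := (hG.2.2 _ _ p (q.mapLe hHG) hp (hq.mapLe hHG) e).1 hep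
  rw [Walk.edges_mapLe_eq_edges] at h1
  have h2 := q.edges_subset_edgeSet h1
  rw [SimpleGraph.edgeSet_fromEdgeSet] at h2
  exact hne h2.1

/-- A unicyclic graph presented as a cycle with rooted trees: `h` is the height above the
cycle, `par` the parent map and `r` the index of the root on the cycle. -/
structure CycleForest (G : SimpleGraph V) (g : ℕ) (vc : ZMod g → V) (h : V → ℕ)
    (par : V → V) (r : V → ZMod g) : Prop where
  connected : G.Connected
  three_le : 3 ≤ g
  inj : Function.Injective vc
  r_vc : ∀ i, r (vc i) = i
  h_vc : ∀ i, h (vc i) = 0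
  vc_r : ∀ x, h x = 0 → vc (r x) = x
  h_par : ∀ x, h x ≠ 0 → h (par x) + 1 = h x
  r_par : ∀ x, h x ≠ 0 → r (par x) = r x
  adj_iff : ∀ x y, G.Adj x y ↔ (h x = 0 ∧ h y = 0 ∧ (r y = r x + 1 ∨ r x = r y + 1)) ∨
    (h x ≠ 0 ∧ par x = y) ∨ (h y ≠ 0 ∧ par y = x)

theorem exists_cycleForest (hG : IsUnicyclic G) (hg : 3 ≤ g) (hvc : IsCycleLabelling G g vc) :
    ∃ h par r, CycleForest G g vc h par r := by
  have : NeZero g := ⟨by omega⟩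
  classical
  have hex : ∀ x, ∃ n, ∃ i, G.dist x (vc i) = n := fun x => ⟨_, 0, rfl⟩
  let h : V → ℕ := fun x => Nat.find (hex x)
  have hh : ∀ x, ∃ i, G.dist x (vc i) = h x := fun x => Nat.find_spec (hex x)
  have hle : ∀ x i, h x ≤ G.dist x (vc i) := fun x i => Nat.find_min' (hex x) ⟨i, rfl⟩
  have hvc0 : ∀ i, h (vc i) = 0 := fun i => by
    have := hle (vc i) i
    simpa using this
  have hpar : ∀ x, ∃ y, h x ≠ 0 → G.Adj x y ∧ h y + 1 = h x := by
    intro x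
    by_cases hx : h x = 0
    · exact ⟨x, fun h => (h hx).elim⟩
    obtain ⟨i, hi⟩ := hh x
    obtain ⟨p, hp⟩ := hG.1.exists_walk_length_eq_dist x (vc i)
    cases p with
    | nil => exact absurd (hvc0 i) hx
    | @cons _ y _ hxy q =>
      refine ⟨y, fun _ => ⟨hxy, ?_⟩⟩
      rw [Walk.length_cons] at hp
      have h1 := hle y i
      have h2 : G.dist y (vc i) ≤ q.length := dist_le q
      obtain ⟨j, hj⟩ := hh y
      have h3 := hle x j
      have h4 : G.dist x (vc j) ≤ G.dist x y + G.dist y (vc j) := hG.1.dist_triangle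
      rw [dist_eq_one_iff_adj.2 hxy] at h4
      omega
  choose par hpar using hpar
  have hroot : ∀ n x, h x = n → ∃ i, par^[n] x = vc i := by
    intro n
    induction n with
    | zero =>
      intro x hx
      obtain ⟨i, hi⟩ := hh x
      rw [hx, hG.1.dist_eq_zero_iff] at hi
      exact ⟨i, hi⟩
    | succ n ih =>
      intro x hx
      have := (hpar x (by omega)).2
      simpa using ih (par x) (by omega)
  choose r hr using fun x => hroot _ x rfl
  have hadjpar : ∀ x, h x ≠ 0 → G.Adj x (par x) := fun x hx => (hpar x hx).1
  have hhpar : ∀ x, h x ≠ 0 → h (par x) + 1 = h x := fun x hx => (hpar x hx).2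
  have hrpar : ∀ x, h x ≠ 0 → r (par x) = r x := by
    intro x hx
    apply hvc.1
    rw [← hr, ← hr, ← hhpar x hx]
    simp
  have hrvc : ∀ i, r (vc i) = i := fun i => by
    apply hvc.1
    rw [← hr, hvc0]
    rfl
  have hvcr : ∀ x, h x = 0 → vc (r x) = x := fun x hx => by
    rw [← hr, hx]
    rfl
  refine ⟨h, par, r, hG.1, hg, hvc.1, hrvc, hvc0, hvcr, hhpar, hrpar, fun x y => ⟨?_, ?_⟩⟩
  · intro hxy
    by_contra hcon
    push Not at hcon
    obtain ⟨hc1, hc2, hc3⟩ := hcon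
    have hnot : s(x, y) ∉ cycleEdges g vc := by
      rintro ⟨i, hi⟩
      rw [Sym2.eq_iff] at hi
      rcases hi with ⟨rfl, rfl⟩ | ⟨rfl, rfl⟩
      · exact (hc1 (hvc0 _) (hvc0 _)).1 (by rw [hrvc, hrvc])
      · exact (hc1 (hvc0 _) (hvc0 _)).2 (by rw [hrvc, hrvc])
    have hb := isBridge_of_notMem_cycleEdges hG hg hvc (e := s(x, y)) hxy hnot
    rw [isBridge_iff] at hb
    apply hb
    have hup : ∀ n z, h z = n → (G.deleteEdges {s(x, y)}).Reachable z (vc (r z)) := by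
      intro n
      induction n with
      | zero => intro z hz; rw [hvcr z hz]
      | succ n ih =>
        intro z hz
        have hz0 : h z ≠ 0 := by omega
        have h1 := ih (par z) (by have := hhpar z hz0; omega)
        rw [hrpar z hz0] at h1
        refine Reachable.trans (Adj.reachable ?_) h1
        rw [deleteEdges_adj]
        refine ⟨hadjpar z hz0, fun he => ?_⟩
        rcases Sym2.eq_iff.1 he with ⟨rfl, h2⟩ | ⟨rfl, h2⟩
        · exact hc2 hz0 h2
        · exact hc3 hz0 h2
    have hcyc : ∀ i, (G.deleteEdges {s(x, y)}).Reachable (vc (0 + 1)) (vc i) :=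
      reachable_cycle_of_adj 0 fun i _ => by
        rw [deleteEdges_adj]
        refine ⟨hvc.2 i, fun he => hnot ⟨i, ?_⟩⟩
        exact (Set.mem_singleton_iff.1 he).symm
    exact ((hup _ x rfl).trans (hcyc _).symm).trans ((hcyc _).trans (hup _ y rfl).symm)
  · rintro (⟨hx, hy, h1 | h1⟩ | ⟨hx, rfl⟩ | ⟨hy, rfl⟩)
    · rw [← hvcr x hx, ← hvcr y hy, h1]
      exact hvc.2 _
    · rw [← hvcr x hx, ← hvcr y hy, h1]
      exact (hvc.2 _).symm
    · exact hadjpar x hx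
    · exact (hadjpar y hy).symm

end Structure

section CycleDistance

variable {g : ℕ}

theorem ZMod.val_sub_eq_ite [NeZero g] (a b : ZMod g) :
    (a - b).val = if b.val ≤ a.val then a.val - b.val else g + a.val - b.val := by
  have ha := a.val_lt
  have hb := b.val_lt
  split_ifs with h
  · exact ZMod.val_sub h
  · have h1 : a - b = ((g + a.val - b.val : ℕ) : ZMod g) := by
      rw [Nat.cast_sub (by omega)]
      simp
    rw [h1, ZMod.val_natCast, Nat.mod_eq_of_lt (by omega)]

theorem ZMod.val_add_eq_ite [NeZero g] (a b : ZMod g) :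
    (a + b).val = if a.val + b.val < g then a.val + b.val else a.val + b.val - g := by
  have ha := a.val_lt
  have hb := b.val_lt
  split_ifs with h
  · exact ZMod.val_add_of_lt h
  · rw [ZMod.val_add, Nat.mod_eq_sub_mod (by omega), Nat.mod_eq_of_lt (by omega)]

theorem ZMod.val_one_of_three_le (hg : 3 ≤ g) : (1 : ZMod g).val = 1 := by
  have : Fact (1 < g) := ⟨by omega⟩
  exact ZMod.val_one g

/-- Distance between two vertices of a cycle of length `g`. -/
def cycDist (i j : ZMod g) : ℕ := min (i - j).val (j - i).val

theorem cycDist_comm (i j : ZMod g) : cycDist i j = cycDist j i := min_comm _ _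

theorem cycDist_self (i : ZMod g) : cycDist i i = 0 := by simp [cycDist]

theorem cycDist_add_one_le [NeZero g] (hg : 3 ≤ g) (i j : ZMod g) :
    cycDist i j ≤ cycDist (i + 1) j + 1 ∧ cycDist (i + 1) j ≤ cycDist i j + 1 := by
  have h1 := ZMod.val_add_eq_ite i 1
  have hi := i.val_lt
  have hj := j.val_lt
  simp only [cycDist, ZMod.val_sub_eq_ite, h1, ZMod.val_one_of_three_le hg]
  split_ifs <;> omega

/-- Distance from a cycle vertex to the edge `v_j v_{j+1}` of a cycle of length `g`. -/
def cycEdgeDist (i j : ZMod g) : ℕ := min (cycDist i j) (cycDist i (j + 1))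

end CycleDistance

section Below

variable {V : Type*}

/-- `y` lies in the subtree of descendants of `c`. -/
def Below (h : V → ℕ) (par : V → V) (c y : V) : Prop :=
  ∃ n, h y = h c + n ∧ par^[n] y = c

variable {G : SimpleGraph V} {g : ℕ} {vc : ZMod g → V} {h : V → ℕ} {par : V → V}
  {r : V → ZMod g}

theorem Below.refl (c : V) : Below h par c c := ⟨0, rfl, rfl⟩

theorem Below.le {c y : V} (hb : Below h par c y) : h c ≤ h y := by
  obtain ⟨n, hn, -⟩ := hb
  omega

theorem Below.eq_of_height_eq {c y : V} (hb : Below h par c y) (he : h y = h c) : y = c := by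
  obtain ⟨n, hn, hp⟩ := hb
  obtain rfl : n = 0 := by omega
  exact hp

namespace CycleForest

variable (F : CycleForest G g vc h par r)
include F

theorem neZero : NeZero g := ⟨by have := F.three_le; omega⟩

theorem adj_par {x : V} (hx : h x ≠ 0) : G.Adj x (par x) :=
  (F.adj_iff _ _).2 (Or.inr (Or.inl ⟨hx, rfl⟩))

theorem below_of_par {c y : V} (hy : h y ≠ 0) (hb : Below h par c (par y)) :
    Below h par c y := by
  obtain ⟨n, hn, hp⟩ := hb
  have := F.h_par y hy
  exact ⟨n + 1, by omega, by simpa using hp⟩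

theorem below_par_of_ne {c y : V} (hb : Below h par c y) (hne : y ≠ c) :
    h y ≠ 0 ∧ Below h par c (par y) := by
  obtain ⟨n, hn, hp⟩ := hb
  cases n with
  | zero => exact absurd hp hne
  | succ n =>
    have h0 : h y ≠ 0 := by omega
    have := F.h_par y h0
    exact ⟨h0, n, by omega, by simpa using hp⟩

theorem below_induction {c : V} {P : V → Prop} (h0 : P c)
    (hs : ∀ y, h y ≠ 0 → Below h par c (par y) → P (par y) → P y) {y : V}
    (hb : Below h par c y) : P y := by
  obtain ⟨n, hn, hp⟩ := hb
  induction n generalizing y with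
  | zero => exact (show y = c from hp) ▸ h0
  | succ n ih =>
    have hy : h y ≠ 0 := by omega
    have h1 := F.h_par y hy
    have h2 : par^[n] (par y) = c := by simpa using hp
    exact hs y hy ⟨n, by omega, h2⟩ (ih (by omega) h2)

theorem below_trans {a b c : V} (hab : Below h par a b) (hbc : Below h par b c) :
    Below h par a c :=
  F.below_induction hab (fun _ hy _ ih => F.below_of_par hy ih) hbc

theorem r_eq_of_below {c y : V} (hb : Below h par c y) : r y = r c :=
  F.below_induction (P := fun y => r y = r c) rfl
    (fun y hy _ ih => by rw [← F.r_par y hy, ih]) hb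

theorem below_of_below_of_le {c d y : V} (hc : Below h par c y) (hd : Below h par d y)
    (hle : h c ≤ h d) : Below h par c d := by
  revert hc
  refine F.below_induction (P := fun y => Below h par c y → Below h par c d) (fun hc => hc)
    (fun z hz hb ih hc => ih ?_) hd
  by_cases hzc : z = c
  · subst hzc
    have := hb.le
    have := F.h_par z hz
    omega
  · exact (F.below_par_of_ne hc hzc).2

theorem exists_ancestor (y : V) (k : ℕ) (hk : k ≤ h y) : ∃ c, h c = k ∧ Below h par c y := by
  obtain ⟨n, hn⟩ : ∃ n, h y = k + n := ⟨h y - k, by omega⟩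
  induction n generalizing y with
  | zero => exact ⟨y, by omega, Below.refl y⟩
  | succ n ih =>
    have hy : h y ≠ 0 := by omega
    have h1 := F.h_par y hy
    obtain ⟨c, hc, hb⟩ := ih (par y) (by omega) (by omega)
    exact ⟨c, hc, F.below_of_par hy hb⟩

theorem not_below_of_height_eq {c d y : V} (hcd : h c = h d) (hne : c ≠ d)
    (hc : Below h par c y) : ¬ Below h par d y := fun hd =>
  hne ((F.below_of_below_of_le hc hd hcd.le).eq_of_height_eq hcd.symm).symm

theorem not_below_par {c : V} (hc : h c ≠ 0) : ¬ Below h par c (par c) := fun hb => by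
  have := hb.le
  have := F.h_par c hc
  omega

theorem h_le_of_adj {x y : V} (hxy : G.Adj x y) : h x ≤ h y + 1 := by
  rcases (F.adj_iff x y).1 hxy with ⟨hx, -, -⟩ | ⟨hx, rfl⟩ | ⟨hy, rfl⟩
  · omega
  · have := F.h_par x hx
    omega
  · have := F.h_par y hy
    omega

/-- The only edge leaving the subtree of `c` joins `c` to its parent. -/
theorem eq_of_adj_of_below {c x y : V} (hc : h c ≠ 0) (hxy : G.Adj x y)
    (hx : Below h par c x) (hy : ¬ Below h par c y) : x = c ∧ y = par c := by
  have hxc := hx.le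
  rcases (F.adj_iff x y).1 hxy with ⟨hx0, -, -⟩ | ⟨hx0, rfl⟩ | ⟨hy0, rfl⟩
  · omega
  · by_cases hne : x = c
    · subst hne
      exact ⟨rfl, rfl⟩
    · exact absurd (F.below_par_of_ne hx hne).2 hy
  · exact absurd (F.below_of_par hy0 hx) hy

omit F in
theorem le_add_dist_of_lipschitz (hconn : G.Connected) (f : V → ℕ)
    (hf : ∀ x y, G.Adj x y → f x ≤ f y + 1) (x y : V) : f x ≤ f y + G.dist x y := by
  obtain ⟨p, hp⟩ := hconn.exists_walk_length_eq_dist x y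
  rw [← hp]
  clear hp
  induction p with
  | nil => simp
  | cons hxy p ih =>
    have := hf _ _ hxy
    rw [Walk.length_cons]
    omega

theorem dist_le_one_add {x y : V} (hxy : G.Adj x y) (z : V) :
    G.dist x z ≤ G.dist y z + 1 := by
  have h1 : G.dist x z ≤ G.dist x y + G.dist y z := F.connected.dist_triangle
  rw [dist_eq_one_iff_adj.2 hxy] at h1
  omega

theorem h_le_h_add_dist (x y : V) : h x ≤ h y + G.dist x y :=
  le_add_dist_of_lipschitz F.connected h (fun _ _ hxy => F.h_le_of_adj hxy) x y

theorem dist_of_below {c y : V} (hb : Below h par c y) : h c + G.dist y c = h y := by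
  have h1 := F.h_le_h_add_dist y c
  refine le_antisymm ?_ h1
  refine F.below_induction (P := fun y => h c + G.dist y c ≤ h y) (by simp)
    (fun y hy _ ih => ?_) hb
  have h2 := F.h_par y hy
  have h3 := F.dist_le_one_add (F.adj_par hy) c
  omega

theorem dist_of_below_of_not_below {c s y : V} (hc : h c ≠ 0) (hs : Below h par c s)
    (hy : ¬ Below h par c y) : G.dist s y = G.dist s c + 1 + G.dist (par c) y := by
  have hsc := F.dist_of_below hs
  refine le_antisymm ?_ ?_
  · have h1 : G.dist s y ≤ G.dist s c + G.dist c y := F.connected.dist_triangle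
    have h2 := F.dist_le_one_add (F.adj_par hc) y
    omega
  · classical
    let f : V → ℕ := fun z =>
      if Below h par c z then G.dist (par c) y + 1 + (h z - h c) else G.dist z y
    have key := le_add_dist_of_lipschitz F.connected f (fun x z hxz => ?_) s y
    · simp only [f, if_pos hs, if_neg hy, dist_self] at key
      omega
    · by_cases hx : Below h par c x <;> by_cases hz : Below h par c z
      · simp only [f, if_pos hx, if_pos hz]
        have h1 := F.h_le_of_adj hxz
        have h2 := hz.le
        omega
      · obtain ⟨rfl, rfl⟩ := F.eq_of_adj_of_below hc hxz hx hz
        simp only [f, if_pos hx, if_neg hz]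
        omega
      · obtain ⟨rfl, rfl⟩ := F.eq_of_adj_of_below hc hxz.symm hz hx
        simp only [f, if_pos hz, if_neg hx]
        omega
      · simp only [f, if_neg hx, if_neg hz]
        exact F.dist_le_one_add hxz y

theorem adj_cycle (i : ZMod g) : G.Adj (vc i) (vc (i + 1)) :=
  (F.adj_iff _ _).2 (Or.inl ⟨F.h_vc _, F.h_vc _, Or.inl (by rw [F.r_vc, F.r_vc])⟩)

theorem dist_vc_le_val (i : ZMod g) (n : ℕ) : G.dist (vc i) (vc (i + n)) ≤ n := by
  induction n with
  | zero => simp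
  | succ n ih =>
    have h1 : G.dist (vc i) (vc (i + n + 1)) ≤ G.dist (vc i) (vc (i + n)) +
        G.dist (vc (i + n)) (vc (i + n + 1)) := F.connected.dist_triangle
    rw [dist_eq_one_iff_adj.2 (F.adj_cycle _)] at h1
    push_cast
    rw [← add_assoc]
    omega

theorem dist_vc (i j : ZMod g) : G.dist (vc i) (vc j) = cycDist i j := by
  have := F.neZero
  refine le_antisymm (le_min ?_ ?_) ?_
  · have := F.dist_vc_le_val j (i - j).val
    rw [SimpleGraph.dist_comm]
    simpa using this
  · have := F.dist_vc_le_val i (j - i).val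
    simpa using this
  · have key := le_add_dist_of_lipschitz F.connected (fun z => cycDist (r z) j)
      (fun x y hxy => ?_) (vc i) (vc j)
    · simpa [F.r_vc, cycDist_self] using key
    · rcases (F.adj_iff x y).1 hxy with ⟨-, -, h1 | h1⟩ | ⟨hx, rfl⟩ | ⟨hy, rfl⟩
      · simp only [h1]
        exact (cycDist_add_one_le F.three_le _ _).1
      · simp only [h1]
        exact (cycDist_add_one_le F.three_le _ _).2
      · simp only [F.r_par x hx]
        omega
      · simp only [F.r_par y hy]
        omega

theorem below_vc_iff {i : ZMod g} {y : V} : Below h par (vc i) y ↔ r y = i := by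
  refine ⟨fun hb => by rw [F.r_eq_of_below hb, F.r_vc], fun hy => ?_⟩
  obtain ⟨c, hc, hb⟩ := F.exists_ancestor y 0 (Nat.zero_le _)
  have h1 : c = vc i := by rw [← hy, F.r_eq_of_below hb, F.vc_r c hc]
  exact h1 ▸ hb

/-- Distances leaving the branch of `s` at the cycle pass through the root of `s`. -/
theorem dist_eq_add_dist_root {s y c : V} (hc : h c = 1) (hs : Below h par c s)
    (hy : ¬ Below h par c y) : G.dist s y = h s + G.dist (vc (r s)) y := by
  have hc0 : h c ≠ 0 := by omega
  have h1 := F.dist_of_below_of_not_below hc0 hs hy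
  have h2 := F.dist_of_below hs
  have h3 := F.h_par c hc0
  have h4 : par c = vc (r s) := by
    rw [F.r_eq_of_below hs, ← F.r_par c hc0, F.vc_r _ (by omega)]
  rw [h4] at h1
  omega

theorem dist_vc_right (s : V) (i : ZMod g) : G.dist s (vc i) = h s + cycDist (r s) i := by
  by_cases hs : h s = 0
  · rw [hs, zero_add, ← F.dist_vc, F.vc_r s hs]
  · obtain ⟨c, hc, hb⟩ := F.exists_ancestor s 1 (by omega)
    rw [F.dist_eq_add_dist_root hc hb, F.dist_vc]
    intro hb'
    have := hb'.le
    rw [F.h_vc] at this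
    omega

theorem dist_of_separated {s y c : V} (hc : h c = 1) (hy : Below h par c y)
    (hs : ¬ Below h par c s) : G.dist s y = h s + cycDist (r s) (r y) + h y := by
  rw [SimpleGraph.dist_comm, F.dist_eq_add_dist_root hc hy hs, SimpleGraph.dist_comm,
    F.dist_vc_right]
  omega

omit F in
theorem edgeDist_mk (s u w : V) : edgeDist G s s(u, w) = min (G.dist s u) (G.dist s w) := rfl

theorem edgeDist_cycle (s : V) (j : ZMod g) :
    edgeDist G s s(vc j, vc (j + 1)) = h s + cycEdgeDist (r s) j := by
  rw [edgeDist_mk, F.dist_vc_right, F.dist_vc_right, cycEdgeDist]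
  omega

/-- Here `c` is the lower endpoint of the edge and `a` its ancestor adjacent to the cycle. -/
theorem edgeDist_tree {s c a : V} (ha : h a = 1) (hc : Below h par a c)
    (hs : ¬ Below h par a s) :
    edgeDist G s s(c, par c) + 1 = h s + cycDist (r s) (r c) + h c := by
  have hac := hc.le
  have hc0 : h c ≠ 0 := by omega
  have hp := F.h_par c hc0
  rw [edgeDist_mk, F.dist_of_separated ha hc hs]
  by_cases hca : c = a
  · subst hca
    rw [← F.vc_r (par c) (by omega), F.dist_vc_right, F.r_par c hc0]
    omega
  · rw [F.dist_of_separated ha (F.below_par_of_ne hc hca).2 hs, F.r_par c hc0]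
    omega

theorem edgeDist_tree_of_below {s c a : V} (ha : h a = 1) (hc : Below h par a c)
    (hs : Below h par a s) : edgeDist G s s(c, par c) + 2 ≤ h s + h c := by
  have hac := hc.le
  have hc0 : h c ≠ 0 := by omega
  have hp := F.h_par c hc0
  have h1 : G.dist s c ≤ G.dist s a + G.dist a c := F.connected.dist_triangle
  have h2 := F.dist_of_below hs
  have h3 := F.dist_of_below hc
  rw [SimpleGraph.dist_comm] at h3
  rw [edgeDist_mk]
  omega

theorem edge_cases {e : Sym2 V} (he : e ∈ G.edgeSet) :
    (∃ j, e = s(vc j, vc (j + 1))) ∨ ∃ c, h c ≠ 0 ∧ e = s(c, par c) := by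
  induction e using Sym2.ind with
  | _ x y =>
    rcases (F.adj_iff x y).1 he with ⟨hx, hy, h1 | h1⟩ | ⟨hx, rfl⟩ | ⟨hy, rfl⟩
    · exact Or.inl ⟨r x, by rw [← h1, F.vc_r x hx, F.vc_r y hy]⟩
    · exact Or.inl ⟨r y, by rw [← h1, F.vc_r x hx, F.vc_r y hy, Sym2.eq_swap]⟩
    · exact Or.inr ⟨x, hx, rfl⟩
    · exact Or.inr ⟨y, hy, Sym2.eq_swap⟩

end CycleForest

end Below

section Threads

variable {V : Type*} [Fintype V] [DecidableEq V]

/-- The children of `y` in a rooted forest with parent map `par` and height `h`. -/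
def children (h : V → ℕ) (par : V → V) (y : V) : Finset V := {c | h c ≠ 0 ∧ par c = y}

theorem mem_children {h : V → ℕ} {par : V → V} {y c : V} :
    c ∈ children h par y ↔ h c ≠ 0 ∧ par c = y := by simp [children]

variable {G : SimpleGraph V} [DecidableRel G.Adj] {g : ℕ} {vc : ZMod g → V} {h : V → ℕ}
  {par : V → V} {r : V → ZMod g}

/-- `c` is the first vertex of a thread hanging at `par c`. -/
def IsHead (G : SimpleGraph V) [DecidableRel G.Adj] (h : V → ℕ) (par : V → V) (c : V) : Prop :=
  h c ≠ 0 ∧ 3 ≤ G.degree (par c) ∧ ∀ y, Below h par c y → (children h par y).card ≤ 1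

namespace CycleForest

variable (F : CycleForest G g vc h par r)
include F

theorem degree_of_ne_zero {y : V} (hy : h y ≠ 0) :
    G.degree y = (children h par y).card + 1 := by
  have h1 : G.neighborFinset y = insert (par y) (children h par y) := by
    ext x
    simp only [mem_neighborFinset, Finset.mem_insert, mem_children, F.adj_iff]
    constructor
    · rintro (h0 | h0 | h0)
      · exact absurd h0.1 hy
      · exact Or.inl h0.2.symm
      · exact Or.inr h0
    · rintro (h0 | h0)
      · exact Or.inr (Or.inl ⟨hy, h0.symm⟩)
      · exact Or.inr (Or.inr h0)
  rw [← card_neighborFinset_eq_degree, h1, Finset.card_insert_of_notMem]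
  rw [mem_children]
  rintro ⟨h2, h3⟩
  have h4 := F.h_par _ h2
  have h5 := F.h_par _ hy
  rw [h3] at h4
  omega

theorem degree_of_eq_zero {y : V} (hy : h y = 0) :
    G.degree y = (children h par y).card + 2 := by
  have h1 : G.neighborFinset y =
      insert (vc (r y + 1)) (insert (vc (r y - 1)) (children h par y)) := by
    ext x
    simp only [mem_neighborFinset, Finset.mem_insert, mem_children, F.adj_iff]
    constructor
    · rintro (h0 | h0 | h0)
      · rcases h0.2.2 with h2 | h2
        · left; rw [← h2, F.vc_r _ h0.2.1]
        · right; left; rw [h2, add_sub_cancel_right, F.vc_r _ h0.2.1]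
      · exact absurd hy h0.1
      · exact Or.inr (Or.inr h0)
    · rintro (h0 | h0 | h0)
      · subst h0
        exact Or.inl ⟨hy, F.h_vc _, Or.inl (F.r_vc _)⟩
      · subst h0
        exact Or.inl ⟨hy, F.h_vc _, Or.inr (by rw [F.r_vc, sub_add_cancel])⟩
      · exact Or.inr (Or.inr h0)
  have h2 : ∀ i, vc i ∉ children h par y := fun i hi => (mem_children.1 hi).1 (F.h_vc i)
  have h3 : vc (r y + 1) ≠ vc (r y - 1) := fun h4 => by
    have h5 := F.inj h4
    rw [sub_eq_add_neg, add_right_inj] at h5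
    apply two_ne_zero_zmod F.three_le
    linear_combination h5
  rw [← card_neighborFinset_eq_degree, h1, Finset.card_insert_of_notMem,
    Finset.card_insert_of_notMem (h2 _)]
  simp [h3, h2]

theorem three_le_degree_of_mem {m c : V} (hm : h m = 0) (hc : c ∈ children h par m) :
    3 ≤ G.degree m := by
  have := F.degree_of_eq_zero hm
  have := Finset.card_pos.2 ⟨c, hc⟩
  omega

theorem three_le_degree_of_two_le {m : V} (hm : 2 ≤ (children h par m).card) :
    3 ≤ G.degree m := by
  by_cases h0 : h m = 0
  · have := F.degree_of_eq_zero h0; omega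
  · have := F.degree_of_ne_zero h0; omega

theorem false_of_not_child (t : List V) : ∀ a b : V, G.Adj a b →
    ¬ (h b ≠ 0 ∧ par b = a) → (b :: t).Nodup → a ∉ b :: t → List.IsChain G.Adj (b :: t) →
    (∀ u ∈ (b :: t).getLast?, G.degree u = 1) → (∀ u ∈ (b :: t).dropLast, G.degree u = 2) →
    False := by
  induction t with
  | nil =>
    intro a b hab hnc _ _ _ hl _
    have h1 : G.degree b = 1 := hl b (by simp)
    rcases (F.adj_iff a b).1 hab with h0 | h0 | h0
    · have := F.degree_of_eq_zero h0.2.1; omega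
    · have h2 := Finset.card_pos.2 ⟨a, mem_children.2 h0⟩
      by_cases hb : h b = 0
      · have := F.degree_of_eq_zero hb; omega
      · have := F.degree_of_ne_zero hb; omega
    · exact hnc h0
  | cons c t ih =>
    intro a b hab hnc hnd hni hch hl hd
    have h1 : G.degree b = 2 := hd b (by simp)
    rw [List.isChain_cons_cons] at hch
    refine ih b c hch.1 ?_ hnd.tail (List.nodup_cons.1 hnd).1 hch.2 ?_ ?_
    · intro hc
      have hac : a ≠ c := fun hac => hni (by simp [hac])
      rcases (F.adj_iff a b).1 hab with h0 | h0 | h0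
      · have := F.degree_of_eq_zero h0.2.1
        have := Finset.card_pos.2 ⟨c, mem_children.2 hc⟩
        omega
      · have h2 : 2 ≤ (children h par b).card :=
          Finset.one_lt_card.2 ⟨a, mem_children.2 h0, c, mem_children.2 hc, hac⟩
        have := F.three_le_degree_of_two_le h2
        omega
      · exact hnc h0
    · intro u hu
      exact hl u (by simpa using hu)
    · intro u hu
      exact hd u (by simp only [List.dropLast_cons_cons, List.mem_cons]; exact Or.inr hu)

theorem isChain_child (t : List V) : ∀ a b : V, h b ≠ 0 → par b = a →
    (b :: t).Nodup → a ∉ b :: t → List.IsChain G.Adj (b :: t) →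
    List.IsChain (fun x y => h y ≠ 0 ∧ par y = x) (a :: b :: t) := by
  induction t with
  | nil => intro a b hb hab _ _ _; simp [hb, hab]
  | cons c t ih =>
    intro a b hb hab hnd hni hch
    rw [List.isChain_cons_cons] at hch
    rw [List.isChain_cons_cons]
    have hc : h c ≠ 0 ∧ par c = b := by
      rcases (F.adj_iff b c).1 hch.1 with h0 | h0 | h0
      · exact absurd h0.1 hb
      · exact absurd (h0.2.symm.trans hab) (fun hca => hni (by simp [hca]))
      · exact h0
    exact ⟨⟨hb, hab⟩, ih b c hc.1 hc.2 hnd.tail (List.nodup_cons.1 hnd).1 hch.2⟩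

theorem mem_of_par_mem (t : List V) : ∀ c y : V,
    List.IsChain (fun x y => h y ≠ 0 ∧ par y = x) (c :: t) → h c ≠ 0 →
    (∀ u ∈ (c :: t).getLast?, G.degree u = 1) → (∀ u ∈ (c :: t).dropLast, G.degree u = 2) →
    h y ≠ 0 → par y ∈ c :: t → y ∈ t := by
  induction t with
  | nil =>
    intro c y _ hc hl _ hy hp
    have h1 : G.degree c = 1 := hl c (by simp)
    have h2 : par y = c := by simpa using hp
    have := F.degree_of_ne_zero hc
    have := Finset.card_pos.2 ⟨y, mem_children.2 ⟨hy, h2⟩⟩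
    omega
  | cons d t ih =>
    intro c y hch hc hl hd hy hp
    have h1 : G.degree c = 2 := hd c (by simp)
    rw [List.isChain_cons_cons] at hch
    rcases List.mem_cons.1 hp with hp | hp
    · have h2 := F.degree_of_ne_zero hc
      by_contra hyt
      have h3 : 2 ≤ (children h par c).card :=
        Finset.one_lt_card.2 ⟨y, mem_children.2 ⟨hy, hp⟩, d, mem_children.2 hch.1,
          fun hyd => hyt (by simp [hyd])⟩
      omega
    · refine List.mem_cons_of_mem _ (ih d y hch.2 hch.1.1 ?_ ?_ hy hp)
      · intro u hu
        exact hl u (by simpa using hu)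
      · intro u hu
        exact hd u (by simp only [List.dropLast_cons_cons, List.mem_cons]; exact Or.inr hu)

theorem below_of_isChain (t : List V) : ∀ c y : V,
    List.IsChain (fun x y => h y ≠ 0 ∧ par y = x) (c :: t) → y ∈ c :: t → Below h par c y := by
  induction t with
  | nil => intro c y _ hy; obtain rfl : y = c := by simpa using hy
           exact Below.refl _
  | cons d t ih =>
    intro c y hch hy
    rw [List.isChain_cons_cons] at hch
    rcases List.mem_cons.1 hy with rfl | hy
    · exact Below.refl _
    · exact F.below_trans (F.below_of_par hch.1.1 (hch.1.2 ▸ Below.refl _)) (ih d y hch.2 hy)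

theorem height_of_isChain (t : List V) : ∀ c : V,
    List.IsChain (fun x y => h y ≠ 0 ∧ par y = x) (c :: t) →
    (∀ y ∈ t, h y ≤ h c + t.length) ∧ ∀ k, k < t.length → ∃ y ∈ t, h y = h c + 1 + k := by
  induction t with
  | nil => intro c _; simp
  | cons d t ih =>
    intro c hch
    rw [List.isChain_cons_cons] at hch
    obtain ⟨h1, h2⟩ := ih d hch.2
    have h3 := F.h_par d hch.1.1
    rw [hch.1.2] at h3
    refine ⟨fun y hy => ?_, fun k hk => ?_⟩
    · rcases List.mem_cons.1 hy with rfl | hy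
      · simp; omega
      · have := h1 y hy
        simp; omega
    · cases k with
      | zero => exact ⟨d, by simp, by omega⟩
      | succ k =>
        obtain ⟨y, hy, hk⟩ := h2 k (by simpa using hk)
        exact ⟨y, by simp [hy], by omega⟩

/-- Structure of the threads of a unicyclic graph. -/
theorem thread_structure {v : V} {t : List V} (ht : IsThreadAt G v t) :
    ∃ c, t.head? = some c ∧ IsHead G h par c ∧ par c = v ∧ (∀ y, y ∈ t ↔ Below h par c y) ∧
      List.IsChain (fun x y => h y ≠ 0 ∧ par y = x) (v :: t) := by
  obtain ⟨hne, hnd, hni, hdv, hch, hhd, hl, hd⟩ := ht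
  unfold List.Chain' at hch
  cases t with
  | nil => exact absurd rfl hne
  | cons c t =>
    have hvc : G.Adj v c := hhd c (by simp)
    have hcv : h c ≠ 0 ∧ par c = v := by
      by_contra hcon
      exact F.false_of_not_child t v c hvc hcon hnd hni hch hl hd
    have h1 := F.isChain_child t v c hcv.1 hcv.2 hnd hni hch
    have h2 := (List.isChain_cons_cons.1 h1).2
    have hmem : ∀ y, y ∈ c :: t ↔ Below h par c y := fun y => by
      refine ⟨F.below_of_isChain t c y h2, fun hb => ?_⟩
      refine F.below_induction (P := fun y => y ∈ c :: t) (by simp) (fun y hy _ ih => ?_) hb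
      exact List.mem_cons_of_mem _ (F.mem_of_par_mem t c y h2 hcv.1 hl hd hy ih)
    refine ⟨c, rfl, ⟨hcv.1, hcv.2 ▸ hdv, fun y hy => ?_⟩, hcv.2, hmem, h1⟩
    have hy0 : h y ≠ 0 := by have := hy.le; have := hcv.1; omega
    have h3 := F.degree_of_ne_zero hy0
    have h4 : G.degree y ≤ 2 := by
      have h5 := (hmem y).2 hy
      by_cases h6 : some y = (c :: t).getLast?
      · rw [hl y (Option.mem_def.2 h6.symm)]; omega
      · exact (hd y (List.mem_dropLast_of_mem_of_ne_getLast? h5 h6)).le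
    omega


theorem exists_isChain_of_thin (n : ℕ) : ∀ c : V, h c ≠ 0 → (∀ y, h y ≤ h c + n) →
    (∀ y, Below h par c y → (children h par y).card ≤ 1) →
    ∃ t, List.IsChain (fun x y => h y ≠ 0 ∧ par y = x) (c :: t) ∧
      (∀ u ∈ (c :: t).getLast?, G.degree u = 1) ∧ ∀ u ∈ (c :: t).dropLast, G.degree u = 2 := by
  induction n with
  | zero =>
    intro c hc hn _
    refine ⟨[], by simp, ?_, by simp⟩
    intro u hu
    obtain rfl : c = u := by simpa using hu
    rw [F.degree_of_ne_zero hc, Nat.add_eq_right, Finset.card_eq_zero,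
      Finset.eq_empty_iff_forall_notMem]
    intro y hy
    rw [mem_children] at hy
    have h1 := F.h_par y hy.1
    have := hn y
    rw [hy.2] at h1
    omega
  | succ n ih =>
    intro c hc hn hthin
    have hdeg := F.degree_of_ne_zero hc
    rcases Nat.eq_zero_or_pos (children h par c).card with h0 | h0
    · refine ⟨[], by simp, ?_, by simp⟩
      intro u hu
      obtain rfl : c = u := by simpa using hu
      omega
    · have h1 : (children h par c).card = 1 := le_antisymm (hthin c (Below.refl c)) h0
      obtain ⟨d, hd⟩ := Finset.card_pos.1 h0
      rw [mem_children] at hd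
      have h2 := F.h_par d hd.1
      rw [hd.2] at h2
      have hcd : Below h par c d := F.below_of_par hd.1 (hd.2 ▸ Below.refl _)
      obtain ⟨t, ht1, ht2, ht3⟩ := ih d hd.1 (fun y => by have := hn y; omega)
        (fun y hy => hthin y (F.below_trans hcd hy))
      refine ⟨d :: t, List.isChain_cons_cons.2 ⟨hd, ht1⟩, ?_, ?_⟩
      · intro u hu
        exact ht2 u (by simpa using hu)
      · intro u hu
        simp only [List.dropLast_cons_cons, List.mem_cons] at hu
        rcases hu with rfl | hu
        · omega
        · exact ht3 u hu

theorem pairwise_of_isChain {l : List V}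
    (hl : List.IsChain (fun x y => h y ≠ 0 ∧ par y = x) l) :
    l.Pairwise (fun x y => h x < h y) := by
  have : IsTrans V (fun x y => h x < h y) := ⟨fun _ _ _ h1 h2 => h1.trans h2⟩
  refine List.IsChain.pairwise (hl.imp fun x y hxy => ?_)
  have := F.h_par y hxy.1
  rw [hxy.2] at this
  omega

theorem exists_thread {c : V} (hc : IsHead G h par c) :
    ∃ t, IsThreadAt G (par c) t ∧ t.head? = some c := by
  obtain ⟨t, ht1, ht2, ht3⟩ := F.exists_isChain_of_thin (Finset.univ.sup h) c hc.1
    (fun y => (Finset.le_sup (Finset.mem_univ y)).trans (Nat.le_add_left _ _)) hc.2.2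
  have hpw := F.pairwise_of_isChain
    (List.isChain_cons_cons.2 ⟨⟨hc.1, rfl⟩, ht1⟩ : List.IsChain _ (par c :: c :: t))
  rw [List.pairwise_cons] at hpw
  refine ⟨c :: t, ⟨by simp, hpw.2.imp fun hlt => fun he => by subst he; omega, fun hm => ?_, hc.2.1,
    ?_, ?_, ht2, ht3⟩, rfl⟩
  · exact absurd (hpw.1 _ hm) (lt_irrefl _)
  · refine List.IsChain.imp (R := fun x y => h y ≠ 0 ∧ par y = x) (fun x y hxy => ?_) ht1
    exact hxy.2 ▸ (F.adj_par hxy.1).symm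
  · intro u hu
    obtain rfl : c = u := by simpa using hu
    exact (F.adj_par hc.1).symm

theorem thread_eq_of_head_eq {v w : V} {t t' : List V} (ht : IsThreadAt G v t)
    (ht' : IsThreadAt G w t') (he : t.head? = t'.head?) : t = t' := by
  obtain ⟨c, h1, -, -, h2, h3⟩ := F.thread_structure ht
  obtain ⟨c', h1', -, -, h2', h3'⟩ := F.thread_structure ht'
  obtain rfl : c = c' := by rw [h1, h1'] at he; exact Option.some.inj he
  have hp : t.Perm t' := (List.perm_ext_iff_of_nodup ht.2.1 ht'.2.1).2 fun y => by
    rw [h2, h2']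
  exact hp.eq_of_pairwise (fun a b _ _ hab hba => absurd hab (not_lt.2 hba.le))
    (F.pairwise_of_isChain h3).tail (F.pairwise_of_isChain h3').tail

theorem numThreads_eq (v : V) :
    numThreads G v = {c | IsHead G h par c ∧ par c = v}.ncard := by
  classical
  have hinj : Set.InjOn (fun t : List V => t.head?) {t | IsThreadAt G v t} :=
    fun t ht t' ht' he => F.thread_eq_of_head_eq ht ht' he
  rw [numThreads, ← hinj.ncard_image,
    ← Set.ncard_image_of_injective _ (Option.some_injective V)]
  congr 1
  ext o
  constructor
  · rintro ⟨t, ht, rfl⟩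
    obtain ⟨c, h1, h2, h3, -, -⟩ := F.thread_structure ht
    exact ⟨c, ⟨h2, h3⟩, h1.symm⟩
  · rintro ⟨c, ⟨h2, rfl⟩, rfl⟩
    obtain ⟨t, ht, hc⟩ := F.exists_thread h2
    exact ⟨t, ht, hc⟩

theorem branchResolving_iff (S : Set V) : BranchResolving G S ↔
    ∀ c c', IsHead G h par c → IsHead G h par c' → par c = par c' → c ≠ c' →
      ∃ s ∈ S, Below h par c s ∨ Below h par c' s := by
  constructor
  · intro hS c c' hc hc' hp hne
    obtain ⟨t, ht, htc⟩ := F.exists_thread hc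
    obtain ⟨t', ht', htc'⟩ := F.exists_thread hc'
    have hne' : t ≠ t' := fun he => by
      rw [he, htc'] at htc
      exact hne (Option.some.inj htc).symm
    obtain ⟨d, hd, -, -, hm, -⟩ := F.thread_structure ht
    obtain ⟨d', hd', -, -, hm', -⟩ := F.thread_structure ht'
    obtain rfl : c = d := Option.some.inj (htc.symm.trans hd)
    obtain rfl : c' = d' := Option.some.inj (htc'.symm.trans hd')
    rcases hS _ t t' ht (hp ▸ ht') hne' with ⟨s, hs, hst⟩ | ⟨s, hs, hst⟩
    · exact ⟨s, hs, Or.inl ((hm s).1 hst)⟩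
    · exact ⟨s, hs, Or.inr ((hm' s).1 hst)⟩
  · intro hS v t t' ht ht' hne
    obtain ⟨c, hc, hh, hp, hm, -⟩ := F.thread_structure ht
    obtain ⟨c', hc', hh', hp', hm', -⟩ := F.thread_structure ht'
    have hcc : c ≠ c' := fun he => hne (F.thread_eq_of_head_eq ht ht' (by rw [hc, hc', he]))
    obtain ⟨s, hs, hb | hb⟩ := hS c c' hh hh' (hp.trans hp'.symm) hcc
    · exact Or.inl ⟨s, hs, (hm s).2 hb⟩
    · exact Or.inr ⟨s, hs, (hm' s).2 hb⟩

/-- A subtree avoided by a branch-resolving set is a thread. -/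
theorem isHead_of_forall_not_below {S : Set V} (hS : BranchResolving G S) {c : V} (hc : h c ≠ 0)
    (hdeg : 3 ≤ G.degree (par c)) (hfree : ∀ s ∈ S, ¬ Below h par c s) : IsHead G h par c := by
  refine ⟨hc, hdeg, ?_⟩
  by_contra! hcon
  obtain ⟨y0, hy0⟩ := hcon
  obtain ⟨y, hy, hmax⟩ := Set.Finite.exists_maximalFor h
    {y | Below h par c y ∧ 1 < (children h par y).card} (Set.toFinite _) ⟨y0, hy0⟩
  obtain ⟨d, hd, d', hd', hne⟩ := Finset.one_lt_card.1 hy.2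
  rw [mem_children] at hd hd'
  have hdy := F.three_le_degree_of_two_le hy.2
  have key : ∀ d, h d ≠ 0 ∧ par d = y → IsHead G h par d ∧ Below h par c d := by
    intro d hd
    have hb : Below h par c d := F.below_of_par hd.1 (hd.2 ▸ hy.1)
    refine ⟨⟨hd.1, hd.2 ▸ hdy, fun z hz => ?_⟩, hb⟩
    by_contra! hz2
    have h1 := hmax ⟨F.below_trans hb hz, hz2⟩
    have h2 := F.h_par d hd.1
    have h3 := hz.le
    rw [hd.2] at h2
    have := h1 (by omega)
    omega
  obtain ⟨s, hs, hb | hb⟩ := (F.branchResolving_iff S).1 hS d d' (key d hd).1 (key d' hd').1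
    (hd.2.trans hd'.2.symm) hne
  · exact hfree s hs (F.below_trans (key d hd).2 hb)
  · exact hfree s hs (F.below_trans (key d' hd').2 hb)

/-- Free threads of length at least `n + 1` in terms of the forest structure. -/
theorem exists_free_thread_iff (S : Set V) (v : V) (n : ℕ) :
    (∃ t, IsThreadAt G v t ∧ SFree S t ∧ n + 1 ≤ t.length) ↔
    ∃ c, IsHead G h par c ∧ par c = v ∧ (∀ s ∈ S, ¬ Below h par c s) ∧
      ∃ y, Below h par c y ∧ h y = h v + 1 + n := by
  constructor
  · rintro ⟨t, ht, hf, hn⟩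
    obtain ⟨c, hc, hh, hp, hm, hch⟩ := F.thread_structure ht
    obtain ⟨y, hy, hyh⟩ := (F.height_of_isChain t v hch).2 n hn
    exact ⟨c, hh, hp, fun s hs hb => hf s ((hm s).2 hb) hs, y, (hm y).1 hy, hyh⟩
  · rintro ⟨c, hh, rfl, hf, y, hy, hyh⟩
    obtain ⟨t, ht, hc⟩ := F.exists_thread hh
    obtain ⟨c', hc', -, -, hm, hch⟩ := F.thread_structure ht
    obtain rfl : c = c' := Option.some.inj (hc.symm.trans hc')
    have h1 := (F.height_of_isChain t _ hch).1 y ((hm y).2 hy)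
    exact ⟨t, ht, fun u hu hs => hf u hs ((hm u).1 hu), by omega⟩

end CycleForest
end Threads

section Counting

variable {V : Type*} [Fintype V] [DecidableEq V]
variable {G : SimpleGraph V} [DecidableRel G.Adj] {g : ℕ} {vc : ZMod g → V} {h : V → ℕ}
  {par : V → V} {r : V → ZMod g}

namespace CycleForest

variable (F : CycleForest G g vc h par r)
include F

theorem mem_range_iff {x : V} : x ∈ Set.range vc ↔ h x = 0 :=
  ⟨fun ⟨i, hi⟩ => hi ▸ F.h_vc i, fun hx => ⟨r x, F.vc_r x hx⟩⟩

theorem inTree_iff {i : ZMod g} {x : V} : inTree G g vc i x ↔ r x = i := by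
  have hadj : ∀ x y, (offCycle G g vc).Adj x y ↔ G.Adj x y ∧ s(x, y) ∉ cycleEdges g vc :=
    fun x y => by simp [offCycle, deleteEdges_adj]
  constructor
  · rintro ⟨w⟩
    have : ∀ {a b : V}, (offCycle G g vc).Walk a b → r b = r a := by
      intro a b w
      induction w with
      | nil => rfl
      | @cons a c b hac _ ih =>
        rw [ih]
        rw [hadj] at hac
        rcases (F.adj_iff _ _).1 hac.1 with h0 | h0 | h0
        · refine absurd ?_ hac.2
          rcases h0.2.2 with h1 | h1
          · exact ⟨r a, by rw [← h1, F.vc_r _ h0.1, F.vc_r _ h0.2.1]⟩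
          · exact ⟨r c, by rw [← h1, F.vc_r _ h0.1, F.vc_r _ h0.2.1, Sym2.eq_swap]⟩
        · rw [← h0.2, F.r_par _ h0.1]
        · rw [← h0.2, F.r_par _ h0.1]
    rw [this w, F.r_vc]
  · intro hx
    refine F.below_induction (P := fun y => inTree G g vc i y) (Reachable.refl _)
      (fun y hy _ ih => ?_) (F.below_vc_iff.2 hx)
    refine ih.trans (Adj.reachable ?_)
    rw [hadj]
    refine ⟨(F.adj_par hy).symm, ?_⟩
    rintro ⟨j, hj⟩
    have : y ∈ s(vc j, vc (j + 1)) := by rw [← hj]; simp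
    rcases Sym2.mem_iff.1 this with h1 | h1
    · exact hy (h1 ▸ F.h_vc _)
    · exact hy (h1 ▸ F.h_vc _)

theorem sActive_iff {S : Set V} {i : ZMod g} : SActive G g vc S i ↔ ∃ s ∈ S, r s = i := by
  simp only [SActive, F.inTree_iff]

theorem aS_eq (S : Finset V) : aS G g vc S = (S.image r).card := by
  rw [aS, ← Set.ncard_coe_finset]
  congr 1
  ext i
  simp [F.sActive_iff]

theorem branchActive_iff {i : ZMod g} :
    BranchActive G g vc i ↔ ∃ x, r x = i ∧ 2 ≤ (children h par x).card := by
  simp only [BranchActive, F.inTree_iff, Branching, F.mem_range_iff]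
  refine exists_congr fun x => and_congr_right fun _ => ?_
  by_cases hx : h x = 0
  · have := F.degree_of_eq_zero hx; omega
  · have := F.degree_of_ne_zero hx; omega

theorem exists_mem_of_branchActive {S : Set V} (hS : BranchResolving G S) {i : ZMod g}
    (hi : BranchActive G g vc i) : ∃ s ∈ S, r s = i := by
  obtain ⟨x, rfl, hx⟩ := F.branchActive_iff.1 hi
  obtain ⟨d, hd, d', hd', hne⟩ := Finset.one_lt_card.1 hx
  rw [mem_children] at hd hd'
  have hdeg := F.three_le_degree_of_two_le hx
  have hr : ∀ d, h d ≠ 0 ∧ par d = x → ∀ s, Below h par d s → r s = r x := fun d hd s hs => by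
    rw [F.r_eq_of_below hs, ← F.r_par d hd.1, hd.2]
  by_contra! hcon
  obtain ⟨s, hs, hb | hb⟩ := (F.branchResolving_iff S).1 hS d d'
    (F.isHead_of_forall_not_below hS hd.1 (hd.2 ▸ hdeg) fun s hs hb => hcon s hs (hr d hd s hb))
    (F.isHead_of_forall_not_below hS hd'.1 (hd'.2 ▸ hdeg)
      fun s hs hb => hcon s hs (hr d' hd' s hb)) (hd.2.trans hd'.2.symm) hne
  · exact hcon s hs (hr d hd s hb)
  · exact hcon s hs (hr d' hd' s hb)

theorem head_eq_of_below {c c' s : V} (hc : IsHead G h par c) (hc' : IsHead G h par c')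
    (hs : Below h par c s) (hs' : Below h par c' s) : c = c' := by
  have key : ∀ c c', IsHead G h par c → IsHead G h par c' → Below h par c s →
      Below h par c' s → h c ≤ h c' → c = c' := by
    intro c c' hc hc' hs hs' hle
    by_contra hne
    have h1 := F.below_par_of_ne (F.below_of_below_of_le hs hs' hle) (Ne.symm hne)
    have h2 : h (par c') ≠ 0 := by have := h1.2.le; have := hc.1; omega
    have := F.degree_of_ne_zero h2
    have := hc'.2.1
    have := hc.2.2 _ h1.2
    omega
  rcases le_total (h c) (h c') with hle | hle
  · exact key c c' hc hc' hs hs' hle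
  · exact (key c' c hc' hc hs' hs hle).symm

open Classical in
theorem numThreads_eq_card (v : V) :
    numThreads G v = ({c | IsHead G h par c ∧ par c = v} : Finset V).card := by
  rw [F.numThreads_eq, ← Set.ncard_coe_finset]
  congr 1
  ext
  simp

open Classical in
theorem bG_eq : haveI := F.neZero
    bG G g vc = ({i | BranchActive G g vc i} : Finset (ZMod g)).card := by
  rw [bG, ← Set.ncard_coe_finset]
  congr 1
  ext
  simp

open Classical in
theorem le_card {S : Finset V} (hS : BranchResolving G S) (hb : Biactive G g vc S) :
    LG G + (2 - bG G g vc) ≤ S.card := by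
  have := F.neZero
  let H : V → Finset V := fun v => {c | IsHead G h par c ∧ par c = v}
  have hH : ∀ v c, c ∈ H v ↔ IsHead G h par c ∧ par c = v := fun v c => by simp [H]
  let Q : V → Finset V := fun v =>
    if 2 ≤ (H v).card then (H v).filter (fun c => ∃ s ∈ S, Below h par c s) else ∅
  have hQ : ∀ v c, c ∈ Q v → IsHead G h par c ∧ par c = v ∧ 2 ≤ (H v).card ∧
      ∃ s ∈ S, Below h par c s := by
    intro v c hc
    by_cases h2 : 2 ≤ (H v).card
    · simp only [Q, h2, if_true, Finset.mem_filter, hH] at hc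
      exact ⟨hc.1.1, hc.1.2, h2, hc.2⟩
    · simp [Q, h2] at hc
  have h1 : ∀ v, numThreads G v - 1 ≤ (Q v).card := by
    intro v
    rw [F.numThreads_eq_card v]
    change (H v).card - 1 ≤ _
    by_cases h2 : 2 ≤ (H v).card
    · have h3 : ((H v).filter (fun c => ¬ ∃ s ∈ S, Below h par c s)).card ≤ 1 := by
        rw [Finset.card_le_one]
        intro c hc c' hc'
        rw [Finset.mem_filter, hH] at hc hc'
        by_contra hne
        obtain ⟨s, hs, hbs | hbs⟩ := (F.branchResolving_iff _).1 hS c c' hc.1.1 hc'.1.1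
          (hc.1.2.trans hc'.1.2.symm) hne
        · exact hc.2 ⟨s, hs, hbs⟩
        · exact hc'.2 ⟨s, hs, hbs⟩
      have h4 := Finset.card_filter_add_card_filter_not (s := H v)
        (fun c => ∃ s ∈ S, Below h par c s)
      simp only [Q, h2, if_true]
      omega
    · omega
  have h2 : LG G ≤ (Finset.univ.biUnion Q).card := by
    rw [Finset.card_biUnion]
    · exact Finset.sum_le_sum fun v _ => h1 v
    · intro v _ w _ hvw
      rw [Function.onFun, Finset.disjoint_left]
      intro c hc hc'
      exact hvw ((hQ v c hc).2.1.symm.trans (hQ w c hc').2.1)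
  have h3 : (Finset.univ.biUnion Q).card ≤ (S.filter fun s => BranchActive G g vc (r s)).card := by
    have hex : ∀ c ∈ Finset.univ.biUnion Q, ∃ s ∈ S, Below h par c s := by
      intro c hc
      obtain ⟨v, -, hv⟩ := Finset.mem_biUnion.1 hc
      exact (hQ v c hv).2.2.2
    choose! f hf using hex
    refine Finset.card_le_card_of_injOn f (fun c hc => ?_) (fun c hc c' hc' he => ?_)
    · obtain ⟨v, -, hv⟩ := Finset.mem_biUnion.1 hc
      obtain ⟨hh, hp, h2, -⟩ := hQ v c hv
      refine Finset.mem_coe.2 (Finset.mem_filter.2 ⟨(hf c hc).1, ?_⟩)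
      rw [F.r_eq_of_below (hf c hc).2, ← F.r_par c hh.1, hp]
      refine F.branchActive_iff.2 ⟨v, rfl, h2.trans (Finset.card_le_card fun d hd => ?_)⟩
      rw [hH] at hd
      exact mem_children.2 ⟨hd.1.1, hd.2⟩
    · obtain ⟨v, -, hv⟩ := Finset.mem_biUnion.1 hc
      obtain ⟨v', -, hv'⟩ := Finset.mem_biUnion.1 hc'
      have h5 := (hf c' hc').2
      rw [← he] at h5
      exact F.head_eq_of_below (hQ v c hv).1 (hQ v' c' hv').1 (hf c hc).2 h5
  have h4 : 2 ≤ bG G g vc + (S.filter fun s => ¬ BranchActive G g vc (r s)).card := by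
    rw [Biactive, F.aS_eq] at hb
    rw [F.bG_eq]
    refine hb.trans ((Finset.card_le_card (t := _ ∪ (S.filter fun s =>
      ¬ BranchActive G g vc (r s)).image r) ?_).trans ((Finset.card_union_le _ _).trans
      (Nat.add_le_add_left Finset.card_image_le _)))
    intro i hi
    obtain ⟨s, hs, rfl⟩ := Finset.mem_image.1 hi
    by_cases hba : BranchActive G g vc (r s)
    · exact Finset.mem_union_left _ (by simpa using hba)
    · exact Finset.mem_union_right _ (Finset.mem_image_of_mem _ (Finset.mem_filter.2 ⟨hs, hba⟩))
  have h5 := Finset.card_filter_add_card_filter_not (s := S)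
        (fun s => BranchActive G g vc (r s))
  omega

open Classical in
theorem exists_card_le : ∃ S : Finset V, BranchResolving G (S : Set V) ∧
    Biactive G g vc (S : Set V) ∧ S.card ≤ LG G + (2 - bG G g vc) := by
  have := F.neZero
  let H : V → Finset V := fun v => {c | IsHead G h par c ∧ par c = v}
  have hH : ∀ v c, c ∈ H v ↔ IsHead G h par c ∧ par c = v := fun v c => by simp [H]
  have hch : ∀ v, ∃ c, (H v).Nonempty → c ∈ H v := fun v => by
    by_cases hv : (H v).Nonempty
    · exact ⟨hv.choose, fun _ => hv.choose_spec⟩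
    · exact ⟨v, fun h => absurd h hv⟩
  choose e he using hch
  let S0 : Finset V := Finset.univ.biUnion fun v => (H v).erase (e v)
  have hS0 : ∀ c, IsHead G h par c → c ≠ e (par c) → c ∈ S0 := fun c hc hne =>
    Finset.mem_biUnion.2 ⟨par c, Finset.mem_univ _, Finset.mem_erase.2 ⟨hne, (hH _ _).2 ⟨hc, rfl⟩⟩⟩
  have hcard : S0.card ≤ LG G := by
    refine Finset.card_biUnion_le.trans (Finset.sum_le_sum fun v _ => ?_)
    rw [F.numThreads_eq_card v]
    change _ ≤ (H v).card - 1
    rcases (H v).eq_empty_or_nonempty with h0 | h0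
    · simp [h0]
    · rw [Finset.card_erase_of_mem (he v h0)]
  let B : Finset (ZMod g) := {i | BranchActive G g vc i}
  have hBb : bG G g vc = B.card := F.bG_eq
  have hBg : B.card ≤ g := by
    simpa [ZMod.card] using Finset.card_le_univ B
  obtain ⟨B', hBB, -, hB'⟩ := Finset.exists_subsuperset_card_eq (Finset.subset_univ B)
    (le_max_left B.card 2) (by rw [Finset.card_univ, ZMod.card]; have := F.three_le; omega)
  have hBR : BranchResolving G ((S0 ∪ (B' \ B).image vc : Finset V) : Set V) := by
    rw [F.branchResolving_iff]
    intro c c' hc hc' hp hne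
    by_cases h1 : c = e (par c)
    · refine ⟨c', ?_, Or.inr (Below.refl _)⟩
      exact Finset.mem_coe.2 (Finset.mem_union_left _ (hS0 c' hc' fun h2 => hne (by rw [h1, h2, hp])))
    · exact ⟨c, Finset.mem_coe.2 (Finset.mem_union_left _ (hS0 c hc h1)), Or.inl (Below.refl _)⟩
  refine ⟨S0 ∪ (B' \ B).image vc, hBR, ?_, ?_⟩
  · rw [Biactive, F.aS_eq]
    refine (hB' ▸ le_max_right B.card 2 : 2 ≤ B'.card).trans (Finset.card_le_card fun i hi => ?_)
    by_cases hiB : i ∈ B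
    · obtain ⟨s, hs, hr⟩ := F.exists_mem_of_branchActive hBR (by simpa [B] using hiB)
      exact Finset.mem_image.2 ⟨s, hs, hr⟩
    · refine Finset.mem_image.2 ⟨vc i, Finset.mem_union_right _ (Finset.mem_image_of_mem _ ?_),
        F.r_vc i⟩
      exact Finset.mem_sdiff.2 ⟨hi, hiB⟩
  · refine (Finset.card_union_le _ _).trans ?_
    have h1 := Finset.card_image_le (s := B' \ B) (f := vc)
    have h2 := Finset.card_sdiff_of_subset hBB
    omega

theorem smallestBBR_iff (S : Finset V) : SmallestBBR G g vc S ↔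
    BranchResolving G (S : Set V) ∧ Biactive G g vc (S : Set V) ∧
      S.card = LG G + (2 - bG G g vc) := by
  constructor
  · rintro ⟨h1, h2, h3⟩
    obtain ⟨S', h1', h2', h3'⟩ := F.exists_card_le
    exact ⟨h1, h2, le_antisymm ((h3 S' h1' h2').trans h3') (F.le_card h1 h2)⟩
  · rintro ⟨h1, h2, h3⟩
    exact ⟨h1, h2, fun S' h1' h2' => h3 ▸ F.le_card h1' h2'⟩

end CycleForest
end Counting

section CycleOffsets

variable {g : ℕ} [NeZero g]

theorem cycDist_eq_of_offset (i a j : ZMod g) : cycDist a j =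
    if (a - i).val ≤ (j - i).val
    then min ((j - i).val - (a - i).val) (g - ((j - i).val - (a - i).val))
    else min ((a - i).val - (j - i).val) (g - ((a - i).val - (j - i).val)) := by
  have h1 : a - j = (a - i) - (j - i) := by ring
  have h2 : j - a = (j - i) - (a - i) := by ring
  have hu := (a - i).val_lt
  have ht := (j - i).val_lt
  rw [cycDist, h1, h2, ZMod.val_sub_eq_ite (a - i) (j - i), ZMod.val_sub_eq_ite (j - i) (a - i)]
  generalize (a - i).val = u at *
  generalize (j - i).val = t at *
  split_ifs <;> omega

theorem cycDist_eq_offset (a i : ZMod g) : cycDist a i = min (a - i).val (g - (a - i).val) := by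
  rw [cycDist_eq_of_offset i a i, sub_self, ZMod.val_zero]
  split_ifs <;> omega

theorem val_add_one_sub (hg : 3 ≤ g) (i j : ZMod g) :
    (j + 1 - i).val = if (j - i).val + 1 < g then (j - i).val + 1 else 0 := by
  have h1 : j + 1 - i = (j - i) + 1 := by ring
  have ht := (j - i).val_lt
  rw [h1, ZMod.val_add_eq_ite, ZMod.val_one_of_three_le hg]
  split_ifs <;> omega

theorem cycDist_triangle (a i j : ZMod g) : cycDist a j ≤ cycDist a i + cycDist i j := by
  rw [cycDist_eq_of_offset i a j, cycDist_eq_offset a i, cycDist_comm, cycDist_eq_offset j i]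
  have hu := (a - i).val_lt
  have ht := (j - i).val_lt
  split_ifs <;> omega

theorem cycEdgeDist_triangle (a i j : ZMod g) :
    cycEdgeDist a j ≤ cycDist a i + cycEdgeDist i j := by
  have h1 := cycDist_triangle a i j
  have h2 := cycDist_triangle a i (j + 1)
  simp only [cycEdgeDist]
  omega

theorem eq_of_val_sub_eq {i a b : ZMod g} (hab : (a - i).val = (b - i).val) : a = b :=
  sub_left_injective (ZMod.val_injective g hab)

theorem natCast_val_sub (a i : ZMod g) : a = i + ((a - i).val : ℕ) := by
  rw [ZMod.natCast_zmod_val]; ring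

theorem eq_sub_of_val (a i : ZMod g) : a = i - ((g - (a - i).val : ℕ) : ZMod g) := by
  have hu := (a - i).val_lt
  rw [Nat.cast_sub hu.le, ZMod.natCast_self, ZMod.natCast_zmod_val]; ring

theorem offset_of_tree_cycle (hg : 3 ≤ g) {i j a : ZMod g} {x : ℕ}
    (he : cycDist a i + x = cycEdgeDist a j) :
    (x = (j - i).val → (i - a).val ≤ (g - 1) / 2) ∧
    (x + (j - i).val + 1 = g → (a - i).val ≤ (g - 1) / 2) ∧
    (x ≠ (j - i).val → x + (j - i).val + 1 ≠ g →
      2 * (a - i).val + x = (j - i).val ∨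
      2 * (g - (a - i).val) + (j - i).val + x + 1 = g) := by
  have h1 : i - a = 0 - (a - i) := by ring
  have hu := (a - i).val_lt
  have ht := (j - i).val_lt
  rw [cycEdgeDist, cycDist_eq_offset a i, cycDist_eq_of_offset i a j,
    cycDist_eq_of_offset i a (j + 1), val_add_one_sub hg] at he
  rw [h1, ZMod.val_sub_eq_ite 0 (a - i), ZMod.val_zero]
  generalize (a - i).val = u at *
  generalize (j - i).val = t at *
  refine ⟨fun h1 => ?_, fun h1 => ?_, fun h1 h2 => ?_⟩ <;> split_ifs at he ⊢ <;> omega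

theorem offset_of_tree_tree {i j a : ZMod g} {n : ℕ} (hij : (j - i).val ≠ 0)
    (he : cycDist a i + n = cycDist a j) :
    (n = (j - i).val → (i - a).val ≤ (g - 1) / 2) ∧
    (n + (j - i).val = g → (a - i).val ≤ (g - 1) / 2) ∧
    (n ≠ (j - i).val → n + (j - i).val ≠ g →
      2 * (a - i).val + n = (j - i).val ∨
      2 * (g - (a - i).val) + (j - i).val + n = g) := by
  have h1 : i - a = 0 - (a - i) := by ring
  have hu := (a - i).val_lt
  have ht := (j - i).val_lt
  rw [cycDist_eq_offset a i, cycDist_eq_of_offset i a j] at he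
  rw [h1, ZMod.val_sub_eq_ite 0 (a - i), ZMod.val_zero]
  generalize (a - i).val = u at *
  generalize (j - i).val = t at *
  refine ⟨fun h1 => ?_, fun h1 => ?_, fun h1 h2 => ?_⟩ <;> split_ifs at he ⊢ <;> omega

theorem offset_of_cycle_cycle (hg : 3 ≤ g) {i j a : ZMod g} (hij : (j - i).val ≠ 0)
    (he : cycEdgeDist a i = cycEdgeDist a j) :
    2 * (a - i).val = (j - i).val + 1 ∨ 2 * (a - i).val = (j - i).val + 1 + g ∨
      2 * (a - i).val + g = (j - i).val + 1 := by
  have hu := (a - i).val_lt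
  have ht := (j - i).val_lt
  rw [cycEdgeDist, cycEdgeDist, cycDist_eq_of_offset i a j,
    cycDist_eq_of_offset i a (j + 1), cycDist_eq_of_offset i a i, cycDist_eq_of_offset i a (i + 1),
    val_add_one_sub hg, val_add_one_sub hg, sub_self, ZMod.val_zero] at he
  generalize (a - i).val = u at *
  generalize (j - i).val = t at *
  split_ifs at he <;> omega

end CycleOffsets

section Necessary

variable {V : Type*} [Fintype V] [DecidableEq V]
variable {G : SimpleGraph V} [DecidableRel G.Adj] {g : ℕ} {vc : ZMod g → V} {h : V → ℕ}
  {par : V → V} {r : V → ZMod g}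

namespace CycleForest

variable (F : CycleForest G g vc h par r)
include F

theorem edgeDist_of_not_below {c s : V} (hc : h c ≠ 0) (hs : ¬ Below h par c s) :
    edgeDist G s s(c, par c) = G.dist s (par c) := by
  have h1 := F.dist_of_below_of_not_below hc (Below.refl c) hs
  rw [SimpleGraph.dist_self, dist_comm, dist_comm (u := par c)] at h1
  rw [edgeDist_mk]
  omega

theorem par_edge_mem {c : V} (hc : h c ≠ 0) : s(c, par c) ∈ G.edgeSet := F.adj_par hc

theorem cycle_edge_mem (j : ZMod g) : s(vc j, vc (j + 1)) ∈ G.edgeSet := F.adj_cycle j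

theorem par_edge_injective {c c' : V} (hc : h c ≠ 0) (hc' : h c' ≠ 0)
    (he : s(c, par c) = s(c', par c')) : c = c' := by
  rcases Sym2.eq_iff.1 he with h1 | h1
  · exact h1.1
  · have h2 := F.h_par c hc
    have h3 := F.h_par c' hc'
    rw [h1.2] at h2
    rw [← h1.1] at h3
    omega

theorem par_edge_ne_cycle_edge {c : V} (hc : h c ≠ 0) (j : ZMod g) :
    s(c, par c) ≠ s(vc j, vc (j + 1)) := by
  intro he
  rcases Sym2.eq_iff.1 he with h1 | h1
  · exact hc (h1.1 ▸ F.h_vc _)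
  · exact hc (h1.1 ▸ F.h_vc _)

theorem branchResolving_of_isEdgeMG {S : Set V} (hS : IsEdgeMG G S) : BranchResolving G S := by
  rw [F.branchResolving_iff]
  intro c c' hc hc' hp hne
  obtain ⟨s, hs, hd⟩ := hS _ (F.par_edge_mem hc.1) _ (F.par_edge_mem hc'.1)
    (fun he => hne (F.par_edge_injective hc.1 hc'.1 he))
  refine ⟨s, hs, ?_⟩
  by_contra! hcon
  apply hd
  rw [F.edgeDist_of_not_below hc.1 hcon.1, F.edgeDist_of_not_below hc'.1 hcon.2, hp]

theorem biactive_of_isEdgeMG {S : Finset V} (hS : IsEdgeMG G (S : Set V)) :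
    Biactive G g vc (S : Set V) := by
  have := F.neZero
  rw [Biactive, F.aS_eq]
  by_contra! hcon
  have hcon' : (S.image r).card ≤ 1 := by omega
  obtain ⟨a, ha⟩ : ∃ a, ∀ s ∈ S, r s = a := by
    rcases S.eq_empty_or_nonempty with rfl | ⟨s0, hs0⟩
    · exact ⟨0, by simp⟩
    · exact ⟨r s0, fun s hs => Finset.card_le_one.1 hcon' _ (Finset.mem_image_of_mem r hs) _
        (Finset.mem_image_of_mem r hs0)⟩
  obtain ⟨s, hs, hd⟩ := hS _ (F.cycle_edge_mem a) _ (F.cycle_edge_mem (a - 1)) (fun he => by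
    have h1 := cycleEdge_injective F.three_le F.inj he
    rw [eq_comm, sub_eq_self] at h1
    exact one_ne_zero_zmod F.three_le h1)
  apply hd
  rw [F.edgeDist_cycle, F.edgeDist_cycle, ha s hs, cycEdgeDist, cycEdgeDist, sub_add_cancel,
    cycDist_self]
  simp

/-- Two distinct vertices of equal height in the same tree have distinct sibling ancestors. -/
theorem exists_sibling_ancestors (n : ℕ) : ∀ c c' : V, h c = n → h c' = n → c ≠ c' →
    r c = r c' → ∃ d d', d ≠ d' ∧ h d ≠ 0 ∧ h d' ≠ 0 ∧ par d = par d' ∧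
      Below h par d c ∧ Below h par d' c' := by
  induction n with
  | zero =>
    intro c c' hc hc' hne hr
    exact absurd (by rw [← F.vc_r c hc, ← F.vc_r c' hc', hr]) hne
  | succ n ih =>
    intro c c' hc hc' hne hr
    have h0 : h c ≠ 0 := by omega
    have h0' : h c' ≠ 0 := by omega
    have h1 := F.h_par c h0
    have h1' := F.h_par c' h0'
    by_cases hp : par c = par c'
    · exact ⟨c, c', hne, h0, h0', hp, Below.refl _, Below.refl _⟩
    · obtain ⟨d, d', hdd, hd, hd', hpp, hb, hb'⟩ := ih _ _ (by omega) (by omega) hp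
        (by rw [F.r_par c h0, F.r_par c' h0', hr])
      exact ⟨d, d', hdd, hd, hd', hpp, F.below_of_par h0 hb, F.below_of_par h0' hb'⟩

theorem exists_below_of_siblings {S : Set V} (hS : BranchResolving G S) {d d' : V} (hd : h d ≠ 0)
    (hd' : h d' ≠ 0) (hp : par d = par d') (hne : d ≠ d') :
    ∃ s ∈ S, Below h par d s ∨ Below h par d' s := by
  by_contra! hcon
  have hdeg : 3 ≤ G.degree (par d) := F.three_le_degree_of_two_le
    (Finset.one_lt_card.2 ⟨d, mem_children.2 ⟨hd, rfl⟩, d', mem_children.2 ⟨hd', hp.symm⟩, hne⟩)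
  obtain ⟨s, hs, hb⟩ := (F.branchResolving_iff S).1 hS d d'
    (F.isHead_of_forall_not_below hS hd hdeg fun s hs => (hcon s hs).1)
    (F.isHead_of_forall_not_below hS hd' (hp ▸ hdeg) fun s hs => (hcon s hs).2) hp hne
  have := hcon s hs
  tauto

theorem edgeDist_ne_of_siblings {c c' d d' s : V} (hd : h d ≠ 0)
    (hd' : h d' ≠ 0) (hp : par d = par d') (hne : d ≠ d') (hc : h c' ≠ 0) (hh : h c = h c')
    (hdc : Below h par d c) (hdc' : Below h par d' c') (hs : Below h par d s) :
    edgeDist G s s(c, par c) ≠ edgeDist G s s(c', par c') := by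
  have e1 := F.h_par d hd
  have e2 := F.h_par d' hd'
  rw [hp] at e1
  have h1 : ¬ Below h par d' s := F.not_below_of_height_eq (by omega) hne hs
  have h2 : ¬ Below h par c' s := fun hb => h1 (F.below_trans hdc' hb)
  have h3 := F.dist_of_below_of_not_below hd' hdc' h1
  have h4 := F.dist_of_below_of_not_below hd hs (F.not_below_par hd)
  have h5 := F.dist_of_below hdc
  have h6 := F.dist_of_below hdc'
  have h7 := F.connected.dist_triangle (u := s) (v := d) (w := c)
  rw [SimpleGraph.dist_self, hp] at h4
  rw [dist_comm, dist_comm (u := par d')] at h3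
  rw [dist_comm (u := c)] at h5
  rw [F.edgeDist_of_not_below hc h2, edgeDist_mk]
  have h8 := F.dist_le_one_add (F.adj_par hc) s
  rw [dist_comm, dist_comm (u := par c')] at h8
  omega

end CycleForest
end Necessary

section Types

variable {V : Type*} [Fintype V] [DecidableEq V]

/-- A thread avoiding `S`, with at least `n + 1` vertices, hangs at `v`. -/
def FreeThread (G : SimpleGraph V) [DecidableRel G.Adj] (h : V → ℕ) (par : V → V) (S : Finset V)
    (v : V) (n : ℕ) : Prop :=
  ∃ c, IsHead G h par c ∧ par c = v ∧ (∀ s ∈ S, ¬ Below h par c s) ∧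
    ∃ y, Below h par c y ∧ h y = h v + 1 + n

/-- Two antipodal active vertices and no others. -/
def TypeA (g : ℕ) (r : V → ZMod g) (S : Finset V) : Prop :=
  Even g ∧ ∃ a, ∀ s ∈ S, r s = a ∨ r s = a + (g / 2 : ℕ)

/-- A free thread at `v_i` where all active vertices lie on a short arc starting at `v_i`. -/
def TypeD (G : SimpleGraph V) [DecidableRel G.Adj] (g : ℕ) (vc : ZMod g → V) (h : V → ℕ)
    (par : V → V) (r : V → ZMod g) (S : Finset V) : Prop :=
  ∃ i, FreeThread G h par S (vc i) 0 ∧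
    ((∀ s ∈ S, (i - r s).val ≤ (g - 1) / 2) ∨ ∀ s ∈ S, (r s - i).val ≤ (g - 1) / 2)

/-- A long free thread at `v_i` between the only two active vertices `v_{i+u}` and `v_{i-w}`. -/
def TypeE (G : SimpleGraph V) [DecidableRel G.Adj] (g : ℕ) (vc : ZMod g → V) (h : V → ℕ)
    (par : V → V) (r : V → ZMod g) (S : Finset V) : Prop :=
  ∃ (i : ZMod g) (u w x : ℕ), (∃ s ∈ S, r s = i + u) ∧ (∃ s ∈ S, r s = i - w) ∧
    (∀ s ∈ S, r s = i + u ∨ r s = i - w) ∧ 1 ≤ u ∧ 1 ≤ w ∧ u + w + x = g / 2 ∧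
    FreeThread G h par S (vc i) x ∧
    (Even g → FreeThread G h par S (vc (i + (2 * u + x : ℕ))) 0)

theorem FreeThread.mono {G : SimpleGraph V} [DecidableRel G.Adj] {g : ℕ} {vc : ZMod g → V}
    {h : V → ℕ} {par : V → V} {r : V → ZMod g} (F : CycleForest G g vc h par r) {S : Finset V}
    {v : V} {m n : ℕ} (hmn : m ≤ n) (hf : FreeThread G h par S v n) : FreeThread G h par S v m := by
  obtain ⟨c, hc, hp, hf, y, hy, hyh⟩ := hf
  obtain ⟨z, hz, hzy⟩ := F.exists_ancestor y (h v + 1 + m) (by omega)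
  have h1 := F.h_par c hc.1
  rw [hp] at h1
  exact ⟨c, hc, hp, hf, z, F.below_of_below_of_le hy hzy (by omega), hz⟩

variable {G : SimpleGraph V} [DecidableRel G.Adj] {g : ℕ} {vc : ZMod g → V} {h : V → ℕ}
  {par : V → V} {r : V → ZMod g}

namespace CycleForest

variable (F : CycleForest G g vc h par r)
include F

theorem freeThread_of_not_below {S : Finset V} (hS : BranchResolving G (S : Set V)) {a c : V}
    (ha : h a = 1) (hac : Below h par a c) (hfree : ∀ s ∈ S, ¬ Below h par a s) {n : ℕ}
    (hn : h c = n + 1) : FreeThread G h par S (vc (r c)) n := by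
  have h0 : h a ≠ 0 := by omega
  have h1 := F.h_par a h0
  have h2 : par a = vc (r c) := by
    rw [F.r_eq_of_below hac, ← F.r_par a h0, F.vc_r _ (by omega)]
  have h3 : 3 ≤ G.degree (par a) :=
    F.three_le_degree_of_mem (by omega) (mem_children.2 ⟨h0, rfl⟩)
  exact ⟨a, F.isHead_of_forall_not_below hS h0 h3 hfree, h2, hfree, c, hac,
    by rw [F.h_vc]; omega⟩

theorem typeA_of_cycle_cycle {S : Finset V} {s₁ s₂ : V} (hs₁ : s₁ ∈ S) (hs₂ : s₂ ∈ S)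
    (hne : r s₁ ≠ r s₂) {i j : ZMod g} (hij : i ≠ j)
    (he : ∀ s ∈ S, cycEdgeDist (r s) i = cycEdgeDist (r s) j) : TypeA g r S := by
  have := F.neZero
  have hg := F.three_le
  have ht : (j - i).val ≠ 0 := by
    rw [Ne, ZMod.val_eq_zero, sub_eq_zero]
    exact fun h => hij h.symm
  have hoff := fun s hs => offset_of_cycle_cycle hg ht (he s hs)
  have hlt := fun s => (r s - i).val_lt
  have hne' : (r s₁ - i).val ≠ (r s₂ - i).val := fun h => hne (eq_of_val_sub_eq h)
  have heven : Even g := by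
    rw [Nat.even_iff]
    have := hoff s₁ hs₁; have := hoff s₂ hs₂; have := hlt s₁; have := hlt s₂; have := (j - i).val_lt
    omega
  have hg2 : g = g / 2 + g / 2 := by rw [Nat.even_iff] at heven; omega
  have hg3 : ((g / 2 : ℕ) : ZMod g) + (g / 2 : ℕ) = 0 := by
    rw [← Nat.cast_add, ← hg2, ZMod.natCast_self]
  refine ⟨heven, r s₁, fun s hs => ?_⟩
  have h1 := hoff s₁ hs₁; have h2 := hoff s hs; have := hlt s₁; have := hlt s
  have := (j - i).val_lt
  rcases (by omega : (r s - i).val = (r s₁ - i).val ∨ (r s - i).val = (r s₁ - i).val + g / 2 ∨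
    (r s - i).val + g / 2 = (r s₁ - i).val) with h3 | h3 | h3
  · exact Or.inl (eq_of_val_sub_eq h3)
  · right
    rw [natCast_val_sub (r s) i, h3, Nat.cast_add, ← add_assoc, ← natCast_val_sub]
  · right
    rw [natCast_val_sub (r s₁) i, ← h3, Nat.cast_add, ← add_assoc, ← natCast_val_sub, add_assoc,
      hg3, add_zero]

/-- The arithmetic shared by the two ways in which a tree edge at `v_i` can be confused. -/
theorem typeE_of_offsets {S : Finset V} {s₁ s₂ : V} (hs₁ : s₁ ∈ S) (hs₂ : s₂ ∈ S)
    (hne : r s₁ ≠ r s₂) {i : ZMod g} {x p q : ℕ} (hp : x < p) (hq : 0 < q)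
    (hpq : p + q + x = 2 * (g / 2))
    (hoff : ∀ s ∈ S, 2 * (r s - i).val + x = p ∨ 2 * (g - (r s - i).val) = q)
    (hfree : FreeThread G h par S (vc i) x)
    (heven : Even g → FreeThread G h par S (vc (i + p)) 0) :
    TypeE G g vc h par r S := by
  have := F.neZero
  have hlt := fun s => (r s - i).val_lt
  have key : ∃ s ∈ S, ∃ s' ∈ S, 2 * (r s - i).val + x = p ∧ 2 * (g - (r s' - i).val) = q := by
    have hne' : (r s₁ - i).val ≠ (r s₂ - i).val := fun h => hne (eq_of_val_sub_eq h)
    have := hlt s₁; have := hlt s₂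
    rcases hoff s₁ hs₁ with h1 | h1
    · rcases hoff s₂ hs₂ with h2 | h2
      · omega
      · exact ⟨s₁, hs₁, s₂, hs₂, h1, h2⟩
    · rcases hoff s₂ hs₂ with h2 | h2
      · exact ⟨s₂, hs₂, s₁, hs₁, h2, h1⟩
      · omega
  obtain ⟨s, hs, s', hs', h1, h2⟩ := key
  have := hlt s; have := hlt s'
  refine ⟨i, (r s - i).val, g - (r s' - i).val, x, ⟨s, hs, natCast_val_sub _ _⟩,
    ⟨s', hs', eq_sub_of_val _ _⟩, fun z hz => ?_, by omega, by omega, by omega, hfree, ?_⟩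
  · have := hlt z
    rcases hoff z hz with h3 | h3
    · left
      rw [← natCast_val_sub]
      exact eq_of_val_sub_eq (by omega : (r z - i).val = (r s - i).val)
    · right
      rw [← eq_sub_of_val]
      exact eq_of_val_sub_eq (by omega : (r z - i).val = (r s' - i).val)
  · rw [h1]
    exact heven

theorem type_of_tree_cycle {S : Finset V} {s₁ s₂ : V} (hs₁ : s₁ ∈ S) (hs₂ : s₂ ∈ S)
    (hne : r s₁ ≠ r s₂) (hS : BranchResolving G (S : Set V)) {c : V} (hc : h c ≠ 0) {j : ZMod g}
    (he : ∀ s ∈ S, edgeDist G s s(c, par c) = edgeDist G s s(vc j, vc (j + 1))) :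
    TypeD G g vc h par r S ∨ TypeE G g vc h par r S := by
  have := F.neZero
  have hg := F.three_le
  obtain ⟨a, ha, hac⟩ := F.exists_ancestor c 1 (by omega)
  have hra := F.r_eq_of_below hac
  have hrne : ∀ s, r s ≠ r c → ¬ Below h par a s := fun s hs hb =>
    hs ((F.r_eq_of_below hb).trans hra.symm)
  have hfree : ∀ s ∈ S, ¬ Below h par a s := by
    intro s hs hb
    obtain ⟨s', hs', hr'⟩ : ∃ s' ∈ S, r s' ≠ r c := by
      by_cases h1 : r s₁ = r c
      · exact ⟨s₂, hs₂, fun h2 => hne (h1.trans h2.symm)⟩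
      · exact ⟨s₁, hs₁, h1⟩
    have h1 := F.edgeDist_tree_of_below ha hac hb
    have h2 := F.edgeDist_tree ha hac (hrne s' hr')
    rw [he s hs, F.edgeDist_cycle, F.r_eq_of_below hb, ← hra] at h1
    rw [he s' hs', F.edgeDist_cycle] at h2
    have h3 := cycEdgeDist_triangle (r s') (r c) j
    omega
  obtain ⟨x, hx⟩ : ∃ x, h c = x + 1 := ⟨h c - 1, by omega⟩
  have hft := F.freeThread_of_not_below hS ha hac hfree hx
  have heq : ∀ s ∈ S, cycDist (r s) (r c) + x = cycEdgeDist (r s) j := by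
    intro s hs
    have h1 := F.edgeDist_tree ha hac (hfree s hs)
    rw [he s hs, F.edgeDist_cycle] at h1
    omega
  have hoff := fun s hs => offset_of_tree_cycle hg (heq s hs)
  by_cases hxt : x = (j - r c).val
  · exact Or.inl ⟨r c, hft.mono F (Nat.zero_le _), Or.inl fun s hs => (hoff s hs).1 hxt⟩
  by_cases hxt' : x + (j - r c).val + 1 = g
  · exact Or.inl ⟨r c, hft.mono F (Nat.zero_le _), Or.inr fun s hs => (hoff s hs).2.1 hxt'⟩
  have hoff' := fun s hs => (hoff s hs).2.2 hxt hxt'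
  have hlt := fun s => (r s - r c).val_lt
  have hne' : (r s₁ - r c).val ≠ (r s₂ - r c).val := fun h => hne (eq_of_val_sub_eq h)
  have h1 := hoff' s₁ hs₁
  have h2 := hoff' s₂ hs₂
  have := hlt s₁; have := hlt s₂
  have hodd : g % 2 = 1 := by omega
  right
  refine F.typeE_of_offsets hs₁ hs₂ hne (i := r c) (x := x) (p := (j - r c).val)
    (q := g - 1 - (j - r c).val - x) (by omega) (by omega) (by omega) (fun s hs => ?_) hft ?_
  · have := hoff' s hs; have := hlt s
    omega
  · rw [Nat.even_iff]; omega

theorem type_of_tree_tree {S : Finset V} {s₁ s₂ : V} (hs₁ : s₁ ∈ S) (hs₂ : s₂ ∈ S)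
    (hne : r s₁ ≠ r s₂) (hS : BranchResolving G (S : Set V)) {c c' : V}
    (hc' : h c' ≠ 0) (hcc : r c ≠ r c') (hle : h c' ≤ h c)
    (he : ∀ s ∈ S, edgeDist G s s(c, par c) = edgeDist G s s(c', par c')) :
    TypeD G g vc h par r S ∨ TypeE G g vc h par r S := by
  have := F.neZero
  have hg := F.three_le
  obtain ⟨a, ha, hac⟩ := F.exists_ancestor c 1 (by omega)
  obtain ⟨a', ha', hac'⟩ := F.exists_ancestor c' 1 (by omega)
  have hra := F.r_eq_of_below hac
  have hra' := F.r_eq_of_below hac'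
  have hrne : ∀ s, r s ≠ r c → ¬ Below h par a s := fun s hs hb =>
    hs ((F.r_eq_of_below hb).trans hra.symm)
  have hrne' : ∀ s, r s ≠ r c' → ¬ Below h par a' s := fun s hs hb =>
    hs ((F.r_eq_of_below hb).trans hra'.symm)
  have hother : ∀ i, ∃ s' ∈ S, r s' ≠ i := by
    intro i
    by_cases h1 : r s₁ = i
    · exact ⟨s₂, hs₂, fun h2 => hne (h1.trans h2.symm)⟩
    · exact ⟨s₁, hs₁, h1⟩
  have hfree : ∀ s ∈ S, ¬ Below h par a s := by
    intro s hs hb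
    have hrs := (F.r_eq_of_below hb).trans hra.symm
    obtain ⟨s', hs', hr'⟩ := hother (r c)
    have h1 := F.edgeDist_tree_of_below ha hac hb
    have h2 := F.edgeDist_tree ha hac (hrne s' hr')
    have h3 := F.edgeDist_tree ha' hac' (hrne' s (by rw [hrs]; exact hcc))
    have e1 := he s hs
    have e2 := he s' hs'
    rw [hrs] at h3
    by_cases hb' : Below h par a' s'
    · have h4 := F.edgeDist_tree_of_below ha' hac' hb'
      omega
    · have h4 := F.edgeDist_tree ha' hac' hb'
      have h5 := cycDist_triangle (r s') (r c) (r c')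
      omega
  have hfree' : ∀ s ∈ S, ¬ Below h par a' s := by
    intro s hs hb
    have hrs := (F.r_eq_of_below hb).trans hra'.symm
    obtain ⟨s', hs', hr'⟩ := hother (r c')
    have h1 := F.edgeDist_tree_of_below ha' hac' hb
    have h2 := F.edgeDist_tree ha' hac' (hrne' s' hr')
    have h3 := F.edgeDist_tree ha hac (hfree s hs)
    have h4 := F.edgeDist_tree ha hac (hfree s' hs')
    have e1 := he s hs
    have e2 := he s' hs'
    rw [hrs] at h3
    have h5 := cycDist_triangle (r s') (r c') (r c)
    omega
  obtain ⟨x, hx⟩ : ∃ x, h c = x + 1 := ⟨h c - 1, by omega⟩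
  obtain ⟨y, hy⟩ : ∃ y, h c' = y + 1 := ⟨h c' - 1, by omega⟩
  have hft := (F.freeThread_of_not_below hS ha hac hfree hx).mono F (Nat.sub_le x y)
  have hft' := (F.freeThread_of_not_below hS ha' hac' hfree' hy).mono F (Nat.zero_le _)
  have heq : ∀ s ∈ S, cycDist (r s) (r c) + (x - y) = cycDist (r s) (r c') := by
    intro s hs
    have h1 := F.edgeDist_tree ha hac (hfree s hs)
    have h2 := F.edgeDist_tree ha' hac' (hfree' s hs)
    have := he s hs
    omega
  generalize x - y = n at *
  have ht : (r c' - r c).val ≠ 0 := by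
    rw [Ne, ZMod.val_eq_zero, sub_eq_zero]
    exact fun h => hcc h.symm
  have hoff := fun s hs => offset_of_tree_tree ht (heq s hs)
  by_cases hxt : n = (r c' - r c).val
  · exact Or.inl ⟨r c, hft.mono F (Nat.zero_le _), Or.inl fun s hs => (hoff s hs).1 hxt⟩
  by_cases hxt' : n + (r c' - r c).val = g
  · exact Or.inl ⟨r c, hft.mono F (Nat.zero_le _), Or.inr fun s hs => (hoff s hs).2.1 hxt'⟩
  have hoff' := fun s hs => (hoff s hs).2.2 hxt hxt'
  have hlt := fun s => (r s - r c).val_lt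
  have hne' : (r s₁ - r c).val ≠ (r s₂ - r c).val := fun h => hne (eq_of_val_sub_eq h)
  have h1 := hoff' s₁ hs₁
  have h2 := hoff' s₂ hs₂
  have := hlt s₁; have := hlt s₂
  right
  refine F.typeE_of_offsets hs₁ hs₂ hne (i := r c) (x := n) (p := (r c' - r c).val)
    (q := g - (r c' - r c).val - n) (by omega) (by omega) (by omega) (fun s hs => ?_) hft ?_
  · have := hoff' s hs; have := hlt s
    omega
  · intro _
    rw [← natCast_val_sub]
    exact hft'

theorem exists_of_biactive {S : Finset V} (hb : Biactive G g vc (S : Set V)) :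
    ∃ s₁ ∈ S, ∃ s₂ ∈ S, r s₁ ≠ r s₂ := by
  rw [Biactive, F.aS_eq] at hb
  obtain ⟨i, hi, j, hj, hij⟩ := Finset.one_lt_card.1 hb
  obtain ⟨s₁, hs₁, rfl⟩ := Finset.mem_image.1 hi
  obtain ⟨s₂, hs₂, rfl⟩ := Finset.mem_image.1 hj
  exact ⟨s₁, hs₁, s₂, hs₂, hij⟩

/-- A biactive branch-resolving set that is not an edge metric generator has one of the three
types. -/
theorem type_of_not_isEdgeMG {S : Finset V} (hS : BranchResolving G (S : Set V))
    (hb : Biactive G g vc (S : Set V)) (hE : ¬ IsEdgeMG G (S : Set V)) :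
    TypeA g r S ∨ TypeD G g vc h par r S ∨ TypeE G g vc h par r S := by
  obtain ⟨s₁, hs₁, s₂, hs₂, hne⟩ := F.exists_of_biactive hb
  unfold IsEdgeMG at hE
  push Not at hE
  obtain ⟨e, he, f, hf, hef, heq⟩ := hE
  rcases F.edge_cases he with ⟨i, rfl⟩ | ⟨c, hc, rfl⟩
  · rcases F.edge_cases hf with ⟨j, rfl⟩ | ⟨c', hc', rfl⟩
    · left
      refine F.typeA_of_cycle_cycle hs₁ hs₂ hne (i := i) (j := j) (fun hij => hef (by rw [hij]))
        fun s hs => ?_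
      have := heq s hs
      rw [F.edgeDist_cycle, F.edgeDist_cycle] at this
      omega
    · exact Or.inr (F.type_of_tree_cycle hs₁ hs₂ hne hS hc' fun s hs => (heq s hs).symm)
  · rcases F.edge_cases hf with ⟨j, rfl⟩ | ⟨c', hc', rfl⟩
    · exact Or.inr (F.type_of_tree_cycle hs₁ hs₂ hne hS hc heq)
    · by_cases hr : r c = r c'
      · exfalso
        have hcc : c ≠ c' := fun h => hef (by rw [h])
        by_cases hh : h c = h c'
        · obtain ⟨d, d', hdd, hd, hd', hp, hdc, hdc'⟩ :=
            F.exists_sibling_ancestors (h c') c c' hh rfl hcc hr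
          obtain ⟨s, hs, hsb | hsb⟩ := F.exists_below_of_siblings hS hd hd' hp hdd
          · exact F.edgeDist_ne_of_siblings hd hd' hp hdd hc' hh hdc hdc' hsb (heq s hs)
          · exact F.edgeDist_ne_of_siblings hd' hd hp.symm hdd.symm hc hh.symm hdc' hdc hsb
              (heq s hs).symm
        · obtain ⟨s, hs, hrs⟩ : ∃ s ∈ S, r s ≠ r c := by
            by_cases h1 : r s₁ = r c
            · exact ⟨s₂, hs₂, fun h2 => hne (h1.trans h2.symm)⟩
            · exact ⟨s₁, hs₁, h1⟩
          have key : ∀ c, h c ≠ 0 → r s ≠ r c →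
              edgeDist G s s(c, par c) + 1 = h s + cycDist (r s) (r c) + h c := by
            intro c hc hrs
            obtain ⟨a, ha, hac⟩ := F.exists_ancestor c 1 (by omega)
            exact F.edgeDist_tree ha hac fun hb =>
              hrs ((F.r_eq_of_below hb).trans (F.r_eq_of_below hac).symm)
          have h1 := key c hc hrs
          have h2 := key c' hc' (hr ▸ hrs)
          rw [heq s hs, hr] at h1
          omega
      · right
        rcases le_total (h c') (h c) with hle | hle
        · exact F.type_of_tree_tree hs₁ hs₂ hne hS hc' hr hle heq
        · exact F.type_of_tree_tree hs₁ hs₂ hne hS hc (Ne.symm hr) hle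
            fun s hs => (heq s hs).symm

end CycleForest
end Types

section CanonicalLabelling

variable {V : Type*} [Fintype V] [DecidableEq V]
variable {G : SimpleGraph V} [DecidableRel G.Adj] {g : ℕ} {vc : ZMod g → V} {h : V → ℕ}
  {par : V → V} {r : V → ZMod g}

namespace CycleForest

variable (F : CycleForest G g vc h par r)
include F

theorem isCycleLabelling : IsCycleLabelling G g vc := ⟨F.inj, F.adj_cycle⟩

theorem rotate (a : ZMod g) :
    CycleForest G g (fun i => vc (i + a)) h par (fun x => r x - a) where
  connected := F.connected
  three_le := F.three_le
  inj := fun i j hij => add_right_cancel (F.inj hij)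
  r_vc := fun i => by simp [F.r_vc]
  h_vc := fun i => F.h_vc _
  vc_r := fun x hx => by simp [F.vc_r x hx]
  h_par := F.h_par
  r_par := fun x hx => by rw [F.r_par x hx]
  adj_iff := fun x y => by
    rw [F.adj_iff]
    have h1 : ∀ x y, r y - a = r x - a + 1 ↔ r y = r x + 1 := fun x y => by
      constructor <;> intro h2
      · linear_combination h2
      · linear_combination h2
    rw [h1, h1]

theorem reflect (a : ZMod g) :
    CycleForest G g (fun i => vc (a - i)) h par (fun x => a - r x) where
  connected := F.connected
  three_le := F.three_le
  inj := fun i j hij => sub_right_injective (F.inj hij)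
  r_vc := fun i => by simp [F.r_vc]
  h_vc := fun i => F.h_vc _
  vc_r := fun x hx => by simp [F.vc_r x hx]
  h_par := F.h_par
  r_par := fun x hx => by rw [F.r_par x hx]
  adj_iff := fun x y => by
    rw [F.adj_iff]
    have h1 : ∀ x y, a - r y = a - r x + 1 ↔ r x = r y + 1 := fun x y => by
      constructor <;> intro h2
      · linear_combination h2
      · linear_combination h2
    rw [h1, h1, or_comm (a := r x = r y + 1)]

theorem mem_cycleEdges_iff {e : Sym2 V} : e ∈ cycleEdges g vc ↔
    ∃ x y, e = s(x, y) ∧ x ∈ Set.range vc ∧ y ∈ Set.range vc ∧ G.Adj x y := by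
  constructor
  · rintro ⟨i, rfl⟩
    exact ⟨_, _, rfl, ⟨i, rfl⟩, ⟨i + 1, rfl⟩, F.adj_cycle i⟩
  · rintro ⟨x, y, rfl, hx, hy, hxy⟩
    rw [F.mem_range_iff] at hx hy
    rcases (F.adj_iff x y).1 hxy with h0 | h0 | h0
    · rcases h0.2.2 with h1 | h1
      · exact ⟨r x, by rw [← h1, F.vc_r x hx, F.vc_r y hy]⟩
      · exact ⟨r y, by rw [← h1, F.vc_r x hx, F.vc_r y hy, Sym2.eq_swap]⟩
    · exact absurd hx h0.1
    · exact absurd hy h0.1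

theorem aS_congr {vc' : ZMod g → V} {h' : V → ℕ} {par' : V → V} {r' : V → ZMod g}
    (F' : CycleForest G g vc' h' par' r') (hr : Set.range vc' = Set.range vc) (S : Set V) :
    aS G g vc' S = aS G g vc S := by
  have h1 : cycleEdges g vc' = cycleEdges g vc := by
    ext e
    rw [F.mem_cycleEdges_iff, F'.mem_cycleEdges_iff, hr]
  have h2 : ∀ (vc' : ZMod g → V), Set.range vc' = Set.range vc →
      vc' '' {i | ∃ s ∈ S, (offCycle G g vc).Reachable (vc' i) s} =
        {x ∈ Set.range vc | ∃ s ∈ S, (offCycle G g vc).Reachable x s} := by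
    intro vc' hr
    ext x
    constructor
    · rintro ⟨i, hi, rfl⟩
      exact ⟨hr ▸ ⟨i, rfl⟩, hi⟩
    · rintro ⟨hx, hi⟩
      rw [← hr] at hx
      obtain ⟨i, rfl⟩ := hx
      exact ⟨i, hi, rfl⟩
  have h3 : offCycle G g vc' = offCycle G g vc := by rw [offCycle, offCycle, h1]
  unfold aS SActive inTree
  rw [h3, ← Set.ncard_image_of_injective _ F'.inj, ← Set.ncard_image_of_injective _ F.inj,
    h2 vc' hr, h2 vc rfl]

theorem kOf_eq (S : Finset V) : kOf G g vc (S : Set V) = S.sup (fun s => (r s).val) := by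
  have := F.neZero
  have h1 : {n : ℕ | n < g ∧ SActive G g vc (S : Set V) (n : ZMod g)} =
      ((S.image fun s => (r s).val : Finset ℕ) : Set ℕ) := by
    ext n
    simp only [F.sActive_iff, Finset.coe_image, Set.mem_image, Set.mem_ofPred_eq]
    constructor
    · rintro ⟨hn, s, hs, hrs⟩
      exact ⟨s, hs, by rw [hrs, ZMod.val_natCast_of_lt hn]⟩
    · rintro ⟨s, hs, rfl⟩
      exact ⟨ZMod.val_lt _, s, hs, (ZMod.natCast_zmod_val _).symm⟩
  rw [kOf, h1]
  apply le_antisymm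
  · refine csSup_le' fun n hn => ?_
    obtain ⟨s, hs, rfl⟩ := Finset.mem_image.1 (Finset.mem_coe.1 hn)
    exact Finset.le_sup (f := fun s => (r s).val) hs
  · exact Finset.sup_le fun s hs => le_csSup (Finset.bddAbove _)
      (Finset.mem_coe.2 (Finset.mem_image_of_mem _ hs))

/-- Positions of the active vertices in a canonical labelling. -/
theorem canonical_spec {S : Finset V} (hcan : Canonical G g vc (S : Set V)) :
    (∃ s ∈ S, r s = 0) ∧ (∃ s ∈ S, (r s).val = kOf G g vc (S : Set V)) ∧
    (∀ s ∈ S, (r s).val ≤ kOf G g vc (S : Set V)) ∧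
    (∀ s₀ ∈ S, ∃ s ∈ S, kOf G g vc (S : Set V) ≤ (r s - r s₀).val) ∧
    (∀ s₀ ∈ S, ∃ s ∈ S, kOf G g vc (S : Set V) ≤ (r s₀ - r s).val) := by
  obtain ⟨-, h0, hmin⟩ := hcan
  rw [F.sActive_iff] at h0
  obtain ⟨s', hs', h0'⟩ := h0
  have hne : S.Nonempty := ⟨s', hs'⟩
  refine ⟨⟨s', hs', h0'⟩, ?_, ?_, ?_, ?_⟩
  · rw [F.kOf_eq]
    obtain ⟨s, hs, he⟩ := Finset.exists_mem_eq_sup S hne fun s => (r s).val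
    exact ⟨s, hs, he.symm⟩
  · intro s hs
    rw [F.kOf_eq]
    exact Finset.le_sup (f := fun s => (r s).val) hs
  · intro s₀ hs₀
    have F' := F.rotate (r s₀)
    have h1 := hmin _ F'.isCycleLabelling ((Equiv.addRight (r s₀)).surjective.range_comp vc)
      (F'.sActive_iff.2 ⟨s₀, hs₀, sub_self _⟩)
    obtain ⟨s, hs, he⟩ := Finset.exists_mem_eq_sup S hne fun s => (r s - r s₀).val
    rw [F'.kOf_eq, he] at h1
    exact ⟨s, hs, h1⟩
  · intro s₀ hs₀
    have F' := F.reflect (r s₀)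
    have h1 := hmin _ F'.isCycleLabelling ((Equiv.subLeft (r s₀)).surjective.range_comp vc)
      (F'.sActive_iff.2 ⟨s₀, hs₀, sub_self _⟩)
    obtain ⟨s, hs, he⟩ := Finset.exists_mem_eq_sup S hne fun s => (r s₀ - r s).val
    rw [F'.kOf_eq, he] at h1
    exact ⟨s, hs, h1⟩

theorem exists_canonical {S : Finset V} (hne : S.Nonempty) : ∃ vc' : ZMod g → V,
    IsCycleLabelling G g vc' ∧ Set.range vc' = Set.range vc ∧ Canonical G g vc' (S : Set V) := by
  obtain ⟨s₀, hs₀⟩ := hne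
  let P : (ZMod g → V) → Prop := fun vc' => IsCycleLabelling G g vc' ∧
    Set.range vc' = Set.range vc ∧ SActive G g vc' (S : Set V) 0
  have F' := F.rotate (r s₀)
  have hP : ∃ vc', P vc' := ⟨_, F'.isCycleLabelling,
    (Equiv.addRight (r s₀)).surjective.range_comp vc, F'.sActive_iff.2 ⟨s₀, hs₀, sub_self _⟩⟩
  obtain ⟨vc', hvc', hmin⟩ := exists_minimalFor_of_wellFoundedLT P
    (fun vc' => kOf G g vc' (S : Set V)) hP
  refine ⟨vc', hvc'.1, hvc'.2.1, hvc'.1, hvc'.2.2, fun vc'' h1 h2 h3 => ?_⟩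
  rcases le_total (kOf G g vc' (S : Set V)) (kOf G g vc'' (S : Set V)) with hle | hle
  · exact hle
  · exact hmin ⟨h1, h2.trans hvc'.2.1, h3⟩ hle

theorem aS_eq_two {S : Finset V} (hb : Biactive G g vc (S : Set V)) {a b : ZMod g}
    (hab : ∀ s ∈ S, r s = a ∨ r s = b) : aS G g vc (S : Set V) = 2 := by
  refine le_antisymm ?_ hb
  rw [F.aS_eq]
  refine (Finset.card_le_card (t := {a, b}) fun i hi => ?_).trans Finset.card_le_two
  obtain ⟨s, hs, rfl⟩ := Finset.mem_image.1 hi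
  simpa using hab s hs

theorem configA_of_typeA {S : Finset V} (hcan : Canonical G g vc (S : Set V))
    (hb : Biactive G g vc (S : Set V)) (hA : TypeA g r S) : ConfigA G g vc (S : Set V) := by
  have := F.neZero
  have hg := F.three_le
  obtain ⟨⟨s₀, hs₀, h0⟩, ⟨s', hs', hk⟩, hle, -, -⟩ := F.canonical_spec hcan
  obtain ⟨heven, a, ha⟩ := hA
  refine ⟨F.aS_eq_two hb ha, heven, ?_⟩
  have hg2 : g = g / 2 + g / 2 := by rw [Nat.even_iff] at heven; omega
  have hg3 : ((g / 2 : ℕ) : ZMod g) + (g / 2 : ℕ) = 0 := by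
    rw [← Nat.cast_add, ← hg2, ZMod.natCast_self]
  have hv : ((g / 2 : ℕ) : ZMod g).val = g / 2 := ZMod.val_natCast_of_lt (by omega)
  have key : ∀ s ∈ S, r s = 0 ∨ r s = (g / 2 : ℕ) := by
    intro s hs
    rcases ha s₀ hs₀ with h1 | h1
    · rw [h0] at h1
      rw [← h1, zero_add] at ha
      exact ha s hs
    · have h2 : a = (g / 2 : ℕ) := by
        rw [h0] at h1; linear_combination -h1 - hg3
      rw [h2, hg3] at ha
      exact (ha s hs).symm
  obtain ⟨s₁, hs₁, s₂, hs₂, hne⟩ := F.exists_of_biactive hb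
  obtain ⟨s, hs, hrs⟩ : ∃ s ∈ S, r s = (g / 2 : ℕ) := by
    rcases key s₁ hs₁ with h1 | h1
    · rcases key s₂ hs₂ with h2 | h2
      · exact absurd (h1.trans h2.symm) hne
      · exact ⟨s₂, hs₂, h2⟩
    · exact ⟨s₁, hs₁, h1⟩
  have h1 := hle s hs
  rw [hrs, hv] at h1
  rcases key s' hs' with h2 | h2
  · rw [h2, ZMod.val_zero] at hk
    omega
  · rw [← hk, h2, hv]

theorem exists_thread_of_freeThread {S : Finset V} {v : V} {n : ℕ}
    (hf : FreeThread G h par S v n) :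
    ∃ t, IsThreadAt G v t ∧ SFree (S : Set V) t ∧ n + 1 ≤ t.length :=
  (F.exists_free_thread_iff (S : Set V) v n).2 hf

theorem freeThread_of_exists_thread {S : Finset V} {v : V} {n : ℕ}
    (hf : ∃ t, IsThreadAt G v t ∧ SFree (S : Set V) t ∧ n + 1 ≤ t.length) :
    FreeThread G h par S v n :=
  (F.exists_free_thread_iff (S : Set V) v n).1 hf

theorem freeThread_zero_of_exists_thread {S : Finset V} {v : V}
    (hf : ∃ t, IsThreadAt G v t ∧ SFree (S : Set V) t) : FreeThread G h par S v 0 := by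
  obtain ⟨t, ht, hs⟩ := hf
  exact F.freeThread_of_exists_thread ⟨t, ht, hs, List.length_pos_of_ne_nil ht.1⟩

theorem configD_of_typeD {S : Finset V} (hcan : Canonical G g vc (S : Set V))
    (hD : TypeD G g vc h par r S) : ConfigD G g vc (S : Set V) := by
  have := F.neZero
  have hg := F.three_le
  obtain ⟨⟨s₀, hs₀, h0⟩, ⟨s', hs', hk⟩, -, hmin, -⟩ := F.canonical_spec hcan
  have hne : S.Nonempty := ⟨s₀, hs₀⟩
  obtain ⟨i, hft, harc⟩ := hD
  obtain ⟨t, ht, hfree, -⟩ := F.exists_thread_of_freeThread hft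
  have hi := i.val_lt
  have hvk := (r s').val_lt
  have hthread : ∃ t, IsThreadAt G (vc ((i.val : ℕ) : ZMod g)) t ∧ SFree (S : Set V) t :=
    ⟨t, by rwa [ZMod.natCast_zmod_val], hfree⟩
  rcases harc with harc | harc
  · have hkm : kOf G g vc (S : Set V) ≤ (g - 1) / 2 := by
      obtain ⟨s₁, hs₁, hmax⟩ := Finset.exists_max_image S (fun s => (i - r s).val) hne
      obtain ⟨s, hs, hle⟩ := hmin s₁ hs₁
      refine hle.trans ?_
      have h1 : r s - r s₁ = (i - r s₁) - (i - r s) := by ring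
      have hm := hmax s hs
      have ha := harc s₁ hs₁
      rw [h1, ZMod.val_sub_eq_ite (i - r s₁) (i - r s), if_pos hm]
      omega
    have h1 := harc s₀ hs₀
    have h2 := harc s' hs'
    rw [h0, sub_zero] at h1
    rw [ZMod.val_sub_eq_ite i (r s')] at h2
    refine ⟨by omega, i.val, Or.inl ?_, hthread⟩
    split_ifs at h2 <;> omega
  · have hkm : kOf G g vc (S : Set V) ≤ (g - 1) / 2 := by
      obtain ⟨s₁, hs₁, hmax⟩ := Finset.exists_min_image S (fun s => (r s - i).val) hne
      obtain ⟨s, hs, hle⟩ := hmin s₁ hs₁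
      refine hle.trans ?_
      have h1 : r s - r s₁ = (r s - i) - (r s₁ - i) := by ring
      have hm := hmax s hs
      have ha := harc s hs
      rw [h1, ZMod.val_sub_eq_ite (r s - i) (r s₁ - i), if_pos hm]
      omega
    have h1 := harc s₀ hs₀
    have h2 := harc s' hs'
    rw [h0, ZMod.val_sub_eq_ite 0 i, ZMod.val_zero] at h1
    rw [ZMod.val_sub_eq_ite (r s') i] at h2
    refine ⟨by omega, i.val, Or.inr ?_, hthread⟩
    split_ifs at h1 h2 <;> omega

theorem config_of_typeE {S : Finset V} (hcan : Canonical G g vc (S : Set V))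
    (hb : Biactive G g vc (S : Set V)) (hE : TypeE G g vc h par r S) :
    ConfigA G g vc (S : Set V) ∨ ConfigE G g vc (S : Set V) := by
  have := F.neZero
  have hg := F.three_le
  obtain ⟨⟨s₀, hs₀, h0⟩, ⟨s', hs', hk⟩, hle, hmin, -⟩ := F.canonical_spec hcan
  obtain ⟨i, u, w, x, ⟨s₁, hs₁, hr₁⟩, ⟨s₂, hs₂, hr₂⟩, hall, hu, hw, hsum, hft, heven⟩ := hE
  have haS := F.aS_eq_two hb hall
  have hv : ((u + w : ℕ) : ZMod g).val = u + w := ZMod.val_natCast_of_lt (by omega)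
  have h12 : r s₁ = r s₂ + (u + w : ℕ) := by rw [hr₁, hr₂]; push_cast; ring
  rcases hall s₀ hs₀ with h1 | h1
  · left
    rw [← hr₁, h0] at h1
    have h2 : r s₂ = 0 - (u + w : ℕ) := by rw [h1, h12]; ring
    have h3 := hle s₂ hs₂
    rw [h2, ZMod.val_sub_eq_ite 0 _, ZMod.val_zero, hv, if_neg (by omega)] at h3
    obtain ⟨s, hs, h4⟩ := hmin s₂ hs₂
    have h5 : (r s - r s₂).val ≤ u + w := by
      rcases hall s hs with h6 | h6
      · rw [h6, ← hr₁, h12, add_sub_cancel_left, hv]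
      · rw [h6, ← hr₂, sub_self, ZMod.val_zero]; omega
    exact ⟨haS, Nat.even_iff.2 (by omega), by omega⟩
  · right
    rw [← hr₂, h0] at h1
    rw [← h1, zero_add] at h12
    have h2 : i = (w : ℕ) := by rw [hr₂] at h1; linear_combination -h1
    have h3 : kOf G g vc (S : Set V) = u + w := by
      apply le_antisymm
      · rw [← hk]
        rcases hall s' hs' with h6 | h6
        · rw [h6, ← hr₁, h12, hv]
        · rw [h6, ← hr₂, ← h1, ZMod.val_zero]; omega
      · rw [← hv, ← h12]
        exact hle s₁ hs₁
    refine ⟨haS, w, by omega, ?_, fun he => ?_⟩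
    · obtain ⟨t, ht, hfree, hlen⟩ := F.exists_thread_of_freeThread hft
      exact ⟨t, h2 ▸ ht, hfree, by omega⟩
    · obtain ⟨t, ht, hfree, -⟩ := F.exists_thread_of_freeThread (heven he)
      refine ⟨t, ?_, hfree⟩
      have h4 : ((g / 2 + kOf G g vc (S : Set V) - w : ℕ) : ZMod g) = i + (2 * u + x : ℕ) := by
        rw [h2, ← Nat.cast_add, h3]
        congr 1
        omega
      rw [h4]
      exact ht

end CycleForest

theorem containsADE_of_not_isEdgeMG (hG : IsUnicyclic G) (hg : 3 ≤ g)
    (hvc : IsCycleLabelling G g vc) {S : Finset V} (hS : BranchResolving G (S : Set V))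
    (hb : Biactive G g vc (S : Set V)) (hE : ¬ IsEdgeMG G (S : Set V)) :
    ContainsADE G g vc (S : Set V) := by
  obtain ⟨h, par, r, F⟩ := exists_cycleForest hG hg hvc
  obtain ⟨s, hs, -⟩ := F.exists_of_biactive hb
  obtain ⟨vc', hl, hr, hcan⟩ := F.exists_canonical ⟨s, hs⟩
  obtain ⟨h', par', r', F'⟩ := exists_cycleForest hG hg hl
  have hb' : Biactive G g vc' (S : Set V) := by
    rw [Biactive, F.aS_congr F' hr]
    exact hb
  rcases F'.type_of_not_isEdgeMG hS hb' hE with hA | hD | hE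
  · exact Or.inl ⟨vc', hl, hr, hcan, F'.configA_of_typeA hcan hb' hA⟩
  · exact Or.inr (Or.inl ⟨vc', hl, hr, hcan, F'.configD_of_typeD hcan hD⟩)
  · rcases F'.config_of_typeE hcan hb' hE with hA | hE
    · exact Or.inl ⟨vc', hl, hr, hcan, hA⟩
    · exact Or.inr (Or.inr ⟨vc', hl, hr, hcan, hE⟩)

end CanonicalLabelling

section Configurations

variable {g : ℕ} [NeZero g]

theorem cycDist_natCast (a : ZMod g) {n : ℕ} (hn : n < g) : cycDist a (n : ZMod g) =
    if a.val ≤ n then min (n - a.val) (g - (n - a.val))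
    else min (a.val - n) (g - (a.val - n)) := by
  rw [cycDist_eq_of_offset 0 a, sub_zero, sub_zero, ZMod.val_natCast_of_lt hn]

theorem cycEdgeDist_natCast (hg : 3 ≤ g) (a : ZMod g) {n : ℕ} (hn : n < g) :
    cycEdgeDist a (n : ZMod g) =
    if a.val ≤ n then min (n - a.val) (g - (n + 1 - a.val))
    else min (a.val - n - 1) (g - (a.val - n)) := by
  have h1 := val_add_one_sub hg 0 (n : ZMod g)
  have hu := a.val_lt
  rw [sub_zero, sub_zero, ZMod.val_natCast_of_lt hn] at h1
  rw [cycEdgeDist, cycDist_natCast a hn, cycDist_eq_of_offset 0 a, sub_zero, sub_zero, h1]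
  split_ifs <;> omega

end Configurations

section Configurations

variable {V : Type*} [Fintype V] [DecidableEq V] {G : SimpleGraph V} [DecidableRel G.Adj] {g : ℕ}
  {vc : ZMod g → V} {h : V → ℕ} {par : V → V} {r : V → ZMod g}

namespace CycleForest

variable (F : CycleForest G g vc h par r)
include F

theorem exists_edge_of_freeThread {S : Finset V} {i : ZMod g} {n : ℕ}
    (hf : FreeThread G h par S (vc i) n) : ∃ y, h y ≠ 0 ∧ r y = i ∧
      ∀ s ∈ S, edgeDist G s s(y, par y) = h s + (cycDist (r s) i + n) := by
  obtain ⟨c, hc, hp, hfree, y, hy, hyh⟩ := hf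
  have h1 := F.h_par c hc.1
  rw [hp, F.h_vc] at h1
  rw [F.h_vc] at hyh
  have h2 : r y = i := by rw [F.r_eq_of_below hy, ← F.r_par c hc.1, hp, F.r_vc]
  refine ⟨y, by omega, h2, fun s hs => ?_⟩
  have h3 := F.edgeDist_tree (by omega) hy (hfree s hs)
  rw [h2] at h3
  omega

theorem not_isEdgeMG_of_thread_cycle {S : Finset V} {i j : ZMod g} {n : ℕ}
    (hf : FreeThread G h par S (vc i) n)
    (hd : ∀ s ∈ S, cycDist (r s) i + n = cycEdgeDist (r s) j) : ¬ IsEdgeMG G (S : Set V) := by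
  intro hS
  obtain ⟨y, hy, -, hyd⟩ := F.exists_edge_of_freeThread hf
  obtain ⟨s, hs, hne⟩ := hS _ (F.par_edge_mem hy) _ (F.cycle_edge_mem j)
    (F.par_edge_ne_cycle_edge hy j)
  rw [hyd s hs, F.edgeDist_cycle, hd s hs] at hne
  exact hne rfl

theorem not_isEdgeMG_of_thread_thread {S : Finset V} {i j : ZMod g} {n : ℕ} (hij : i ≠ j)
    (hf : FreeThread G h par S (vc i) n) (hf' : FreeThread G h par S (vc j) 0)
    (hd : ∀ s ∈ S, cycDist (r s) i + n = cycDist (r s) j) : ¬ IsEdgeMG G (S : Set V) := by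
  intro hS
  obtain ⟨y, hy, hry, hyd⟩ := F.exists_edge_of_freeThread hf
  obtain ⟨y', hy', hry', hyd'⟩ := F.exists_edge_of_freeThread hf'
  obtain ⟨s, hs, hne⟩ := hS _ (F.par_edge_mem hy) _ (F.par_edge_mem hy') fun he => hij <| by
    rw [← hry, ← hry', F.par_edge_injective hy hy' he]
  rw [hyd s hs, hyd' s hs, hd s hs] at hne
  exact hne rfl

theorem not_isEdgeMG_of_cycle_cycle {S : Finset V} {i j : ZMod g} (hij : i ≠ j)
    (hd : ∀ s ∈ S, cycEdgeDist (r s) i = cycEdgeDist (r s) j) : ¬ IsEdgeMG G (S : Set V) := by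
  intro hS
  obtain ⟨s, hs, hne⟩ := hS _ (F.cycle_edge_mem i) _ (F.cycle_edge_mem j)
    fun he => hij (cycleEdge_injective F.three_le F.inj he)
  rw [F.edgeDist_cycle, F.edgeDist_cycle, hd s hs] at hne
  exact hne rfl

theorem val_eq_of_aS_eq_two {S : Finset V} (hcan : Canonical G g vc (S : Set V))
    (ha : aS G g vc (S : Set V) = 2) : 0 < kOf G g vc (S : Set V) ∧
      2 * kOf G g vc (S : Set V) ≤ g ∧
      ∀ s ∈ S, (r s).val = 0 ∨ (r s).val = kOf G g vc (S : Set V) := by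
  have := F.neZero
  obtain ⟨⟨s₀, hs₀, h0⟩, ⟨s', hs', hk⟩, hle, hmin, -⟩ := F.canonical_spec hcan
  have hpos : 0 < kOf G g vc (S : Set V) := by
    obtain ⟨s₁, hs₁, s₂, hs₂, hne⟩ := F.exists_of_biactive (S := S) ha.ge
    by_contra! hcon
    have h1 := hle s₁ hs₁
    have h2 := hle s₂ hs₂
    exact hne (ZMod.val_injective g (by omega))
  have hne : r s₀ ≠ r s' := by
    intro he
    rw [← he, h0, ZMod.val_zero] at hk
    omega
  rw [F.aS_eq] at ha
  have himg : ({r s₀, r s'} : Finset (ZMod g)) = S.image r := by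
    apply Finset.eq_of_subset_of_card_le
    · intro i hi
      rcases Finset.mem_insert.1 hi with rfl | hi
      · exact Finset.mem_image_of_mem _ hs₀
      · rw [Finset.mem_singleton.1 hi]
        exact Finset.mem_image_of_mem _ hs'
    · rw [ha, Finset.card_pair hne]
  have hall : ∀ s ∈ S, r s = 0 ∨ r s = r s' := by
    intro s hs
    have h1 := Finset.mem_image_of_mem r hs
    rw [← himg, h0] at h1
    simpa using h1
  refine ⟨hpos, ?_, fun s hs => ?_⟩
  · obtain ⟨s, hs, h1⟩ := hmin s' hs'
    have h2 := (r s').val_lt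
    rcases hall s hs with h3 | h3
    · rw [h3, ZMod.val_sub_eq_ite 0 (r s'), ZMod.val_zero, if_neg (by omega)] at h1
      omega
    · rw [h3, sub_self, ZMod.val_zero] at h1
      omega
  · rcases hall s hs with h3 | h3
    · exact Or.inl (by rw [h3, ZMod.val_zero])
    · exact Or.inr (by rw [h3, hk])

theorem not_isEdgeMG_of_antipodal {S : Finset V} (hcan : Canonical G g vc (S : Set V))
    (ha : aS G g vc (S : Set V) = 2) (hk : 2 * kOf G g vc (S : Set V) = g) :
    ¬ IsEdgeMG G (S : Set V) := by
  have := F.neZero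
  have hg := F.three_le
  obtain ⟨-, -, hall⟩ := F.val_eq_of_aS_eq_two hcan ha
  refine F.not_isEdgeMG_of_cycle_cycle (i := (0 : ℕ)) (j := (g - 1 : ℕ)) ?_ fun s hs => ?_
  · intro he
    have h1 := congrArg ZMod.val he
    rw [ZMod.val_natCast_of_lt (by omega), ZMod.val_natCast_of_lt (by omega)] at h1
    omega
  · rw [cycEdgeDist_natCast hg _ (by omega), cycEdgeDist_natCast hg _ (by omega)]
    rcases hall s hs with h1 | h1 <;> rw [h1] <;> split_ifs <;> omega

theorem not_isEdgeMG_of_configD {S : Finset V} (hcan : Canonical G g vc (S : Set V))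
    (hD : ConfigD G g vc (S : Set V)) : ¬ IsEdgeMG G (S : Set V) := by
  have := F.neZero
  have hg := F.three_le
  obtain ⟨-, -, hle, -, -⟩ := F.canonical_spec hcan
  obtain ⟨hk, i, hi, hthread⟩ := hD
  have hf := F.freeThread_zero_of_exists_thread hthread
  rcases hi with hi | hi | rfl
  · refine F.not_isEdgeMG_of_thread_cycle (j := (i : ℕ)) hf fun s hs => ?_
    have h1 := hle s hs
    rw [cycEdgeDist_natCast hg _ (by omega), cycDist_natCast _ (by omega)]
    split_ifs <;> omega
  · refine F.not_isEdgeMG_of_thread_cycle (j := (i - 1 : ℕ)) hf fun s hs => ?_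
    have h1 := hle s hs
    rw [cycEdgeDist_natCast hg _ (by omega), cycDist_natCast _ (by omega)]
    split_ifs <;> omega
  · refine F.not_isEdgeMG_of_thread_cycle (j := (g - 1 : ℕ)) hf fun s hs => ?_
    have h1 := hle s hs
    rw [cycEdgeDist_natCast hg _ (by omega), cycDist_natCast _ (by omega)]
    split_ifs <;> omega

theorem not_isEdgeMG_of_configE {S : Finset V} (hcan : Canonical G g vc (S : Set V))
    (hE : ConfigE G g vc (S : Set V)) : ¬ IsEdgeMG G (S : Set V) := by
  have := F.neZero
  have hg := F.three_le
  obtain ⟨ha, i, hi, ⟨t, ht, hfree, hlen⟩, heven⟩ := hE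
  obtain ⟨hpos, h2k, hall⟩ := F.val_eq_of_aS_eq_two hcan ha
  rcases h2k.eq_or_lt with h2k | h2k
  · exact F.not_isEdgeMG_of_antipodal hcan ha h2k
  have hf := F.freeThread_of_exists_thread ⟨t, ht, hfree, hlen⟩
  rcases Nat.even_or_odd g with he | ho
  · have hf' := F.freeThread_zero_of_exists_thread (heven he)
    rw [Nat.even_iff] at he
    refine F.not_isEdgeMG_of_thread_thread ?_ hf hf' fun s hs => ?_
    · intro he
      have h1 := congrArg ZMod.val he
      rw [ZMod.val_natCast_of_lt (by omega), ZMod.val_natCast_of_lt (by omega)] at h1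
      omega
    · rw [cycDist_natCast _ (by omega), cycDist_natCast _ (by omega)]
      rcases hall s hs with h1 | h1 <;> rw [h1] <;> split_ifs <;> omega
  · rw [Nat.odd_iff] at ho
    refine F.not_isEdgeMG_of_thread_cycle (j := (g / 2 + kOf G g vc (S : Set V) - i : ℕ)) hf
      fun s hs => ?_
    rw [cycDist_natCast _ (by omega), cycEdgeDist_natCast hg _ (by omega)]
    rcases hall s hs with h1 | h1 <;> rw [h1] <;> split_ifs <;> omega

end CycleForest

theorem not_containsADE_of_isEdgeMG (hG : IsUnicyclic G) (hg : 3 ≤ g) {S : Finset V}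
    (hE : IsEdgeMG G (S : Set V)) : ¬ ContainsADE G g vc (S : Set V) := by
  rintro (⟨vc', hl, -, hcan, hA⟩ | ⟨vc', hl, -, hcan, hD⟩ | ⟨vc', hl, -, hcan, hE'⟩)
  · obtain ⟨h', par', r', F'⟩ := exists_cycleForest hG hg hl
    have h1 := hA.2.2
    have h2 := Nat.even_iff.1 hA.2.1
    exact F'.not_isEdgeMG_of_antipodal hcan hA.1 (by omega) hE
  · obtain ⟨h', par', r', F'⟩ := exists_cycleForest hG hg hl
    exact F'.not_isEdgeMG_of_configD hcan hD hE
  · obtain ⟨h', par', r', F'⟩ := exists_cycleForest hG hg hl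
    exact F'.not_isEdgeMG_of_configE hcan hE' hE

end Configurations

section Dimension

variable {V : Type*} [Fintype V] [DecidableEq V] {G : SimpleGraph V} [DecidableRel G.Adj] {g : ℕ}
  {vc : ZMod g → V} {h : V → ℕ} {par : V → V} {r : V → ZMod g}

theorem BranchResolving.mono {S T : Set V} (hST : S ⊆ T) (hS : BranchResolving G S) :
    BranchResolving G T := fun v t₁ t₂ h₁ h₂ hne =>
  (hS v t₁ t₂ h₁ h₂ hne).imp (fun ⟨s, hs, ht⟩ => ⟨s, hST hs, ht⟩) fun ⟨s, hs, ht⟩ => ⟨s, hST hs, ht⟩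

namespace CycleForest

variable (F : CycleForest G g vc h par r)
include F

/-- A branch-resolving set with three active vertices at pairwise gaps at most `g / 2` is an
edge metric generator. -/
theorem isEdgeMG_of_three_active {S : Finset V} (hS : BranchResolving G (S : Set V))
    {s₀ s₁ s₂ : V} (hs₀ : s₀ ∈ S) (hs₁ : s₁ ∈ S) (hs₂ : s₂ ∈ S) {d₁ d₂ : ℕ}
    (hr₁ : r s₁ = r s₀ + d₁) (hr₂ : r s₂ = r s₀ + d₂) (h0 : 0 < d₁) (h12 : d₁ < d₂) (h2 : d₂ < g)
    (hd₁ : d₁ ≤ g / 2) (hd₁₂ : d₂ - d₁ ≤ g / 2) (hd₂ : g - d₂ ≤ g / 2) :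
    IsEdgeMG G (S : Set V) := by
  have := F.neZero
  have hg := F.three_le
  have hv₁ : (d₁ : ZMod g).val = d₁ := ZMod.val_natCast_of_lt (by omega)
  have hv₂ : (d₂ : ZMod g).val = d₂ := ZMod.val_natCast_of_lt h2
  have hne₁ : r s₀ ≠ r s₁ := fun he => by
    rw [hr₁, left_eq_add] at he
    rw [he, ZMod.val_zero] at hv₁
    omega
  have hne₂ : r s₀ ≠ r s₂ := fun he => by
    rw [hr₂, left_eq_add] at he
    rw [he, ZMod.val_zero] at hv₂
    omega
  have hne₁₂ : r s₁ ≠ r s₂ := fun he => by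
    rw [hr₁, hr₂, add_right_inj] at he
    rw [he, hv₂] at hv₁
    omega
  have htwo : ∀ a b, ¬ ∀ s ∈ S, r s = a ∨ r s = b := fun a b hab => by
    have e₀ := hab s₀ hs₀
    have e₁ := hab s₁ hs₁
    have e₂ := hab s₂ hs₂
    grind
  have hb : Biactive G g vc (S : Set V) := by
    rw [Biactive, F.aS_eq]
    exact Finset.one_lt_card.2 ⟨_, Finset.mem_image_of_mem r hs₀, _,
      Finset.mem_image_of_mem r hs₁, hne₁⟩
  by_contra hE
  rcases F.type_of_not_isEdgeMG hS hb hE with ⟨-, a, ha⟩ | ⟨i, -, harc⟩ |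
    ⟨i, u, w, x, -, -, hall, -⟩
  · exact htwo _ _ ha
  · have hlt := (i - r s₀).val_lt
    rcases harc with harc | harc
    · have e₀ := harc s₀ hs₀
      have e₁ := harc s₁ hs₁
      have e₂ := harc s₂ hs₂
      rw [hr₁, ← sub_sub, ZMod.val_sub_eq_ite (i - r s₀), hv₁] at e₁
      rw [hr₂, ← sub_sub, ZMod.val_sub_eq_ite (i - r s₀), hv₂] at e₂
      split_ifs at e₁ e₂ <;> omega
    · have e₀ := harc s₀ hs₀
      have e₁ := harc s₁ hs₁
      have e₂ := harc s₂ hs₂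
      rw [← neg_sub i, ← zero_sub, ZMod.val_sub_eq_ite 0 (i - r s₀), ZMod.val_zero] at e₀
      rw [hr₁, add_comm, ← sub_sub_eq_add_sub, ZMod.val_sub_eq_ite _ (i - r s₀), hv₁] at e₁
      rw [hr₂, add_comm, ← sub_sub_eq_add_sub, ZMod.val_sub_eq_ite _ (i - r s₀), hv₂] at e₂
      split_ifs at e₀ e₁ e₂ <;> omega
  · exact htwo _ _ hall

theorem exists_isEdgeMG_insert {S : Finset V} (hS : BranchResolving G (S : Set V))
    (hb : Biactive G g vc (S : Set V)) :
    ∃ v, IsEdgeMG G ((insert v S : Finset V) : Set V) := by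
  have := F.neZero
  have hg := F.three_le
  obtain ⟨s, hs, t, ht, hd0, hd⟩ : ∃ s ∈ S, ∃ t ∈ S, 0 < (r t - r s).val ∧
      (r t - r s).val ≤ g / 2 := by
    obtain ⟨s, hs, t, ht, hne⟩ := F.exists_of_biactive hb
    have h0 : (r t - r s).val ≠ 0 := fun he => hne (sub_eq_zero.1 ((ZMod.val_eq_zero _).1 he)).symm
    have hlt := (r t - r s).val_lt
    by_cases hle : (r t - r s).val ≤ g / 2
    · exact ⟨s, hs, t, ht, by omega, hle⟩
    · have h1 : (r s - r t).val = g - (r t - r s).val := by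
        rw [← neg_sub (r t) (r s), ← zero_sub, ZMod.val_sub_eq_ite 0 _, ZMod.val_zero,
          if_neg (by omega), add_zero]
      exact ⟨t, ht, s, hs, by omega, by omega⟩
  have hlt := (r t - r s).val_lt
  have hins : ∀ v, BranchResolving G ((insert v S : Finset V) : Set V) := fun v =>
    hS.mono (by simp)
  by_cases heq : (r t - r s).val = (g + 1) / 2
  · exact ⟨vc (r s + (1 : ℕ)), F.isEdgeMG_of_three_active (hins _) (Finset.mem_insert_of_mem hs)
      (Finset.mem_insert_self _ _) (Finset.mem_insert_of_mem ht) (F.r_vc _)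
      (natCast_val_sub (r t) (r s)) one_pos (by omega) hlt (by omega) (by omega) (by omega)⟩
  · exact ⟨vc (r s + ((g + 1) / 2 : ℕ)), F.isEdgeMG_of_three_active (hins _)
      (Finset.mem_insert_of_mem hs) (Finset.mem_insert_of_mem ht) (Finset.mem_insert_self _ _)
      (natCast_val_sub (r t) (r s)) (F.r_vc _) hd0 (by omega) (by omega) hd (by omega) (by omega)⟩

end CycleForest

end Dimension

theorem statement_10 {V : Type*} [Fintype V] [DecidableEq V] (G : SimpleGraph V)
    [DecidableRel G.Adj] (hG : IsUnicyclic G) (g : ℕ) (hg : 3 ≤ g)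
    (vc : ZMod g → V) (hvc : IsCycleLabelling G g vc) :
    (ADEneg G g vc → edgeMetricDim G = LG G + max 0 (2 - bG G g vc)) ∧
    (¬ ADEneg G g vc → edgeMetricDim G = LG G + max 0 (2 - bG G g vc) + 1) := by
  obtain ⟨h, par, r, F⟩ := exists_cycleForest hG hg hvc
  rw [Nat.zero_max]
  have hlower : ∀ S : Finset V, IsEdgeMG G (S : Set V) → LG G + (2 - bG G g vc) ≤ S.card :=
    fun S hS => F.le_card (F.branchResolving_of_isEdgeMG hS) (F.biactive_of_isEdgeMG hS)
  constructor
  · rintro ⟨S, hS, hADE⟩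
    obtain ⟨hBR, hb, hcard⟩ := (F.smallestBBR_iff S).1 hS
    have hE : IsEdgeMG G (S : Set V) := by
      by_contra hE
      exact hADE (containsADE_of_not_isEdgeMG hG hg hvc hBR hb hE)
    refine le_antisymm (Nat.sInf_le ⟨S, hcard, hE⟩) (le_csInf ⟨_, S, hcard, hE⟩ ?_)
    rintro _ ⟨T, rfl, hT⟩
    exact hlower T hT
  · intro hneg
    have hstrict : ∀ S : Finset V, IsEdgeMG G (S : Set V) →
        LG G + (2 - bG G g vc) + 1 ≤ S.card := by
      intro S hS
      refine Nat.succ_le_of_lt (lt_of_le_of_ne (hlower S hS) fun hcard => hneg ⟨S, ?_, ?_⟩)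
      · exact (F.smallestBBR_iff S).2
          ⟨F.branchResolving_of_isEdgeMG hS, F.biactive_of_isEdgeMG hS, hcard.symm⟩
      · exact not_containsADE_of_isEdgeMG hG hg hS
    obtain ⟨S, hBR, hb, hcard⟩ := F.exists_card_le
    obtain ⟨v, hE⟩ := F.exists_isEdgeMG_insert hBR hb
    have h1 := hstrict _ hE
    have h2 := Finset.card_insert_le v S
    have h3 : (insert v S).card = LG G + (2 - bG G g vc) + 1 := by omega
    refine le_antisymm (Nat.sInf_le ⟨_, h3, hE⟩) (le_csInf ⟨_, _, h3, hE⟩ ?_)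
    rintro _ ⟨T, rfl, hT⟩
    exact hstrict T hT
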